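/- arXiv:1406.1958 — 4 statements merged into one kernel-verified Lean document; each statement's English description precedes it below -/
import Mathlib

section
/- Let N ≥ 2 and let λ₃, …, λ_ℓ ∈ ℂ be pairwise distinct with λ_j ≠ i/2 and λ_j ≠ −i/2 for all j, and set c = 2 i^{N+1} ∏_{j=3}^{ℓ} (λ_j + 3i/2)/(λ_j − i/2). Then for every fixed λ ∈ ℂ with λ ≠ i/2, λ ≠ −i/2 and λ ∉ {λ₃,…,λ_ℓ}, the function ε ↦ Λ₂(λ; λ₁(ε), λ₂(ε), λ₃, …, λ_ℓ) is O(ε^{N+1}) as ε → 0; in particular lim_{ε→0} ε^{−N} Λ₂(λ; λ₁(ε), λ₂(ε), λ₃, …, λ_ℓ) = 0. -/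
open Complex Matrix Filter Topology

noncomputable section

/-- The index set of the standard basis of `𝔥_N = (ℂ²)^{⊗N}`. -/
abbrev St (N : ℕ) := Fin N → Fin 2

/-- The Pauli matrices `σ¹, σ², σ³`. -/
def pauli : Fin 3 → Matrix (Fin 2) (Fin 2) ℂ
  | 0 => !![0, 1; 1, 0]
  | 1 => !![0, -Complex.I; Complex.I, 0]
  | 2 => !![1, 0; 0, -1]

/-- The operator `σₖᵃ` on `𝔥_N`, acting as `σᵃ` on the `k`-th tensor factor
and as the identity on the others. -/
def siteOp (N : ℕ) (a : Fin 3) (k : Fin N) : Matrix (St N) (St N) ℂ :=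
  Matrix.of fun x y =>
    pauli a (x k) (y k) * ∏ j ∈ Finset.univ.erase k, (if x j = y j then (1 : ℂ) else 0)

/-- The L-operator `Lₖ(λ) = λ (I ⊗ 𝟙) + (i/2) Σₐ σᵃ ⊗ σₖᵃ` on `ℂ² ⊗ 𝔥_N`. -/
def Lop (N : ℕ) (lam : ℂ) (k : Fin N) : Matrix (Fin 2 × St N) (Fin 2 × St N) ℂ :=
  lam • (1 : Matrix (Fin 2 × St N) (Fin 2 × St N) ℂ) +
    (Complex.I / 2) • ∑ a : Fin 3,
      Matrix.of fun p q : Fin 2 × St N => pauli a p.1 q.1 * siteOp N a k p.2 q.2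

/-- The monodromy matrix `T_N(λ) = L_N(λ) L_{N-1}(λ) ⋯ L_1(λ)`. -/
def monodromy (N : ℕ) (lam : ℂ) : Matrix (Fin 2 × St N) (Fin 2 × St N) ℂ :=
  (((List.finRange N).reverse).map (Lop N lam)).prod

/-- `A_N(λ)`: the (0,0) block of `T_N(λ)` in the auxiliary space. -/
def Aop (N : ℕ) (lam : ℂ) : Matrix (St N) (St N) ℂ :=
  Matrix.of fun x y => monodromy N lam (0, x) (0, y)

/-- `B_N(λ)`: the (0,1) block of `T_N(λ)` in the auxiliary space. -/
def Bop (N : ℕ) (lam : ℂ) : Matrix (St N) (St N) ℂ :=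
  Matrix.of fun x y => monodromy N lam (0, x) (1, y)

/-- `C_N(λ)`: the (1,0) block of `T_N(λ)` in the auxiliary space. -/
def Cop (N : ℕ) (lam : ℂ) : Matrix (St N) (St N) ℂ :=
  Matrix.of fun x y => monodromy N lam (1, x) (0, y)

/-- `D_N(λ)`: the (1,1) block of `T_N(λ)` in the auxiliary space. -/
def Dop (N : ℕ) (lam : ℂ) : Matrix (St N) (St N) ℂ :=
  Matrix.of fun x y => monodromy N lam (1, x) (1, y)

/-- The transfer matrix `τ_N(λ) = A_N(λ) + D_N(λ)`. -/
def tau (N : ℕ) (lam : ℂ) : Matrix (St N) (St N) ℂ := Aop N lam + Dop N lam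

/-- The vacuum vector `|0⟩_N = v₊^{⊗N}`. -/
def vac (N : ℕ) : St N → ℂ := fun x => if x = (fun _ => (0 : Fin 2)) then 1 else 0

/-- Cyclic successor on `Fin N`, implementing periodic boundary conditions. -/
def cyc {N : ℕ} (k : Fin N) : Fin N := ⟨(k.1 + 1) % N, Nat.mod_lt _ k.pos⟩

/-- The XXX Hamiltonian
`ℋ_N = (J/4) Σₖ (σₖ¹σ_{k+1}¹ + σₖ²σ_{k+1}² + σₖ³σ_{k+1}³ − 𝟙)`. -/
def Ham (N : ℕ) (J : ℝ) : Matrix (St N) (St N) ℂ :=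
  ((J : ℂ) / 4) • ∑ k : Fin N,
    ((∑ a : Fin 3, siteOp N a k * siteOp N a (cyc k)) - 1)

/-- The product of creation operators `B_N(λ₁) ⋯ B_N(λ_ℓ)`. -/
def betheProd (N : ℕ) {l : ℕ} (lam : Fin l → ℂ) : Matrix (St N) (St N) ℂ :=
  ((List.finRange l).map fun j => Bop N (lam j)).prod

/-- The Bethe vector `B_N(λ₁) ⋯ B_N(λ_ℓ) |0⟩_N`. -/
def betheVec (N : ℕ) {l : ℕ} (lam : Fin l → ℂ) : St N → ℂ :=
  (betheProd N lam).mulVec (vac N)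

/-- The eigenvalue `Λ(λ; λ₁,…,λ_ℓ)` of the transfer matrix. -/
def Lam (N : ℕ) {l : ℕ} (lam0 : ℂ) (lam : Fin l → ℂ) : ℂ :=
  (lam0 + Complex.I / 2) ^ N * ∏ j, (lam0 - lam j - Complex.I) / (lam0 - lam j) +
    (lam0 - Complex.I / 2) ^ N * ∏ j, (lam j - lam0 - Complex.I) / (lam j - lam0)

/-- The unwanted-term coefficient `Λ_k(λ; λ₁,…,λ_ℓ)`. -/
def LamK (N : ℕ) {l : ℕ} (lam0 : ℂ) (lam : Fin l → ℂ) (k : Fin l) : ℂ :=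
  Complex.I / (lam0 - lam k) *
    ((lam k + Complex.I / 2) ^ N *
        ∏ j ∈ Finset.univ.erase k, (lam k - lam j - Complex.I) / (lam k - lam j) -
      (lam k - Complex.I / 2) ^ N *
        ∏ j ∈ Finset.univ.erase k, (lam j - lam k - Complex.I) / (lam j - lam k))

/-- The Bethe ansatz equations for the spin 1/2 XXX chain of length `N`. -/
def BetheEq (N : ℕ) {l : ℕ} (lam : Fin l → ℂ) : Prop :=
  ∀ k, ((lam k + Complex.I / 2) / (lam k - Complex.I / 2)) ^ N =
    ∏ j ∈ Finset.univ.erase k, (lam k - lam j + Complex.I) / (lam k - lam j - Complex.I)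

/-- Nepomechie–Wang regularization: `λ₁(ε) = i/2 + ε + c ε^N`. -/
def nwLam1 (N : ℕ) (c : ℂ) (eps : ℂ) : ℂ := Complex.I / 2 + eps + c * eps ^ N

/-- Nepomechie–Wang regularization: `λ₂(ε) = −i/2 + ε`. -/
def nwLam2 (eps : ℂ) : ℂ := -(Complex.I / 2) + eps

/-- The regularized tuple `(λ₁(ε), λ₂(ε), λ₃, …, λ_ℓ)`. -/
def nwTuple (N : ℕ) (c : ℂ) {m : ℕ} (mu : Fin m → ℂ) (eps : ℂ) : Fin (m + 2) → ℂ :=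
  Fin.cons (nwLam1 N c eps) (Fin.cons (nwLam2 eps) mu)

/-- The singular tuple `(i/2, −i/2, λ₃, …, λ_ℓ)`. -/
def singTuple {m : ℕ} (mu : Fin m → ℂ) : Fin (m + 2) → ℂ :=
  Fin.cons (Complex.I / 2) (Fin.cons (-(Complex.I / 2)) mu)

/-- The coefficient `Λ₂` of the regularized tuple, with the factor `ε^N` extracted. -/
theorem LamK_nwTuple_one (N : ℕ) {m : ℕ} (mu : Fin m → ℂ) (c lam0 eps : ℂ) :
    LamK N lam0 (nwTuple N c mu eps) 1 =
      eps ^ N * (Complex.I / (lam0 + Complex.I / 2 - eps) / (Complex.I + c * eps ^ N) *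
        ((2 * Complex.I + c * eps ^ N) *
            ∏ j, (mu j + 3 * Complex.I / 2 - eps) / (mu j + Complex.I / 2 - eps) -
          c * (eps - Complex.I) ^ N *
            ∏ j, (mu j - Complex.I / 2 - eps) / (mu j + Complex.I / 2 - eps))) := by
  have hprod (g : Fin (m + 2) → ℂ) :
      ∏ j ∈ Finset.univ.erase 1, g j = g 0 * ∏ j : Fin m, g j.succ.succ := by
    rw [← Finset.compl_singleton, ← Fin.image_succAbove_univ,
      Finset.prod_image Fin.succAbove_right_injective.injOn, Fin.prod_univ_succ]
    rfl
  have h0 : nwTuple N c mu eps 0 = nwLam1 N c eps := rfl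
  have h1 : nwTuple N c mu eps 1 = nwLam2 eps := rfl
  have hs (j : Fin m) : nwTuple N c mu eps j.succ.succ = mu j := rfl
  have hP : ∏ j, (nwLam2 eps - mu j - Complex.I) / (nwLam2 eps - mu j) =
      ∏ j, (mu j + 3 * Complex.I / 2 - eps) / (mu j + Complex.I / 2 - eps) := by
    refine Finset.prod_congr rfl fun j _ => ?_
    rw [← neg_div_neg_eq]
    congr 1 <;> unfold nwLam2 <;> ring
  have hQ : ∏ j, (mu j - nwLam2 eps - Complex.I) / (mu j - nwLam2 eps) =
      ∏ j, (mu j - Complex.I / 2 - eps) / (mu j + Complex.I / 2 - eps) := by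
    refine Finset.prod_congr rfl fun j _ => ?_
    congr 1 <;> unfold nwLam2 <;> ring
  have ha : (nwLam2 eps - nwLam1 N c eps - Complex.I) / (nwLam2 eps - nwLam1 N c eps) =
      (2 * Complex.I + c * eps ^ N) / (Complex.I + c * eps ^ N) := by
    rw [← neg_div_neg_eq]
    congr 1 <;> unfold nwLam2 nwLam1 <;> ring
  have hb : (nwLam1 N c eps - nwLam2 eps - Complex.I) / (nwLam1 N c eps - nwLam2 eps) =
      c * eps ^ N / (Complex.I + c * eps ^ N) := by
    congr 1 <;> unfold nwLam2 nwLam1 <;> ring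
  have hl : lam0 - nwLam2 eps = lam0 + Complex.I / 2 - eps := by unfold nwLam2; ring
  have hu : nwLam2 eps + Complex.I / 2 = eps := by unfold nwLam2; ring
  have hv : nwLam2 eps - Complex.I / 2 = eps - Complex.I := by unfold nwLam2; ring
  unfold LamK
  simp only [hprod, h0, h1, hs, hP, hQ, ha, hb, hl, hu, hv]
  ring

/-- With `c = 2 i^{N+1} ∏ⱼ (λⱼ + 3i/2)/(λⱼ − i/2)`, the coefficient
`Λ₂(λ; λ₁(ε), λ₂(ε), λ₃,…,λ_ℓ)` is `O(ε^{N+1})` as `ε → 0`; in particular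
`ε^{−N} Λ₂ → 0`. -/
theorem LamTwo_asymptotics (N : ℕ) (hN : 2 ≤ N) {m : ℕ} (mu : Fin m → ℂ)
    (hinj : Function.Injective mu)
    (hp : ∀ j, mu j ≠ Complex.I / 2) (hm : ∀ j, mu j ≠ -(Complex.I / 2))
    (c : ℂ)
    (hc : c = 2 * Complex.I ^ (N + 1) *
      ∏ j, (mu j + 3 * Complex.I / 2) / (mu j - Complex.I / 2))
    (lam0 : ℂ) (h0p : lam0 ≠ Complex.I / 2) (h0m : lam0 ≠ -(Complex.I / 2))
    (h0 : ∀ j, lam0 ≠ mu j) :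
    Asymptotics.IsBigO (𝓝[≠] (0 : ℂ))
      (fun eps => LamK N lam0 (nwTuple N c mu eps) 1)
      (fun eps => eps ^ (N + 1)) ∧
    Tendsto (fun eps : ℂ => LamK N lam0 (nwTuple N c mu eps) 1 / eps ^ N)
      (𝓝[≠] (0 : ℂ)) (𝓝 0) := by
  set g : ℂ → ℂ := fun eps =>
    Complex.I / (lam0 + Complex.I / 2 - eps) / (Complex.I + c * eps ^ N) *
      ((2 * Complex.I + c * eps ^ N) *
          ∏ j, (mu j + 3 * Complex.I / 2 - eps) / (mu j + Complex.I / 2 - eps) -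
        c * (eps - Complex.I) ^ N *
          ∏ j, (mu j - Complex.I / 2 - eps) / (mu j + Complex.I / 2 - eps)) with hg
  have hN0 : N ≠ 0 := by omega
  have hmu (j : Fin m) : mu j + Complex.I / 2 - 0 ≠ 0 := by
    simpa [add_eq_zero_iff_eq_neg] using hm j
  have hlam : lam0 + Complex.I / 2 - 0 ≠ 0 := by
    simpa [add_eq_zero_iff_eq_neg] using h0m
  have hg0 : g 0 = 0 := by
    have hcQ : c * (0 - Complex.I) ^ N *
        ∏ j, (mu j - Complex.I / 2 - 0) / (mu j + Complex.I / 2 - 0) =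
        2 * Complex.I * ∏ j, (mu j + 3 * Complex.I / 2 - 0) / (mu j + Complex.I / 2 - 0) := by
      have hI : Complex.I ^ (N + 1) * (0 - Complex.I) ^ N = Complex.I := by
        rw [pow_succ, mul_right_comm, ← mul_pow]
        simp
      have hPQ : (∏ j, (mu j + 3 * Complex.I / 2) / (mu j - Complex.I / 2)) *
          ∏ j, (mu j - Complex.I / 2 - 0) / (mu j + Complex.I / 2 - 0) =
          ∏ j, (mu j + 3 * Complex.I / 2 - 0) / (mu j + Complex.I / 2 - 0) := by
        rw [← Finset.prod_mul_distrib]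
        refine Finset.prod_congr rfl fun j _ => ?_
        simp only [sub_zero]
        rw [div_mul_div_cancel₀ (sub_ne_zero.mpr (hp j))]
      rw [← hPQ, hc]
      linear_combination (2 * (∏ j, (mu j + 3 * Complex.I / 2) / (mu j - Complex.I / 2)) *
          ∏ j, (mu j - Complex.I / 2 - 0) / (mu j + Complex.I / 2 - 0)) * hI
    simp only [hg]
    rw [hcQ, zero_pow hN0]
    ring
  have hgd : DifferentiableAt ℂ g 0 := by
    have hprod (a : Fin m → ℂ) :
        DifferentiableAt ℂ (fun eps => ∏ j, (a j - eps) / (mu j + Complex.I / 2 - eps)) 0 :=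
      DifferentiableAt.fun_finsetProd fun j _ => by
        fun_prop (disch := exact hmu j)
    have h1 := hprod fun j => mu j + 3 * Complex.I / 2
    have h2 := hprod fun j => mu j - Complex.I / 2
    have hd : Complex.I + c * 0 ^ N ≠ 0 := by simp [hN0]
    have h3 : DifferentiableAt ℂ (fun eps => Complex.I / (lam0 + Complex.I / 2 - eps)) 0 := by
      fun_prop (disch := exact hlam)
    have h4 : DifferentiableAt ℂ (fun eps : ℂ => Complex.I + c * eps ^ N) 0 := by fun_prop
    have h5 : DifferentiableAt ℂ (fun eps : ℂ => 2 * Complex.I + c * eps ^ N) 0 := by fun_prop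
    have h6 : DifferentiableAt ℂ (fun eps : ℂ => c * (eps - Complex.I) ^ N) 0 := by fun_prop
    exact (h3.fun_div h4 hd).fun_mul ((h5.fun_mul h1).fun_sub (h6.fun_mul h2))
  have hgO : g =O[𝓝[≠] 0] fun eps => eps := by
    simpa [hg0] using hgd.isBigO_sub.mono nhdsWithin_le_nhds
  have hO : (fun eps => LamK N lam0 (nwTuple N c mu eps) 1) =O[𝓝[≠] 0]
      fun eps => eps ^ (N + 1) := by
    simp only [LamK_nwTuple_one, pow_succ]
    exact (Asymptotics.isBigO_refl _ _).mul hgO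
  refine ⟨hO, ?_⟩
  have hgt : Tendsto g (𝓝[≠] 0) (𝓝 0) := by
    simpa [hg0] using hgd.continuousAt.tendsto.mono_left nhdsWithin_le_nhds
  refine hgt.congr' ?_
  filter_upwards [self_mem_nhdsWithin] with eps heps
  rw [LamK_nwTuple_one, mul_div_cancel_left₀ _ (pow_ne_zero N heps)]
end
end

section
/- Let N ≥ 2 and let λ₃, …, λ_ℓ ∈ ℂ be pairwise distinct with λ_j ∉ {i/2, −i/2} for all j, and suppose c ∈ ℂ satisfies both c = −(2/i^{N+1}) ∏_{j=3}^{ℓ} (λ_j − 3i/2)/(λ_j + i/2) and c = 2 i^{N+1} ∏_{j=3}^{ℓ} (λ_j + 3i/2)/(λ_j − i/2). Then the limit Ψ = lim_{ε→0} ε^{−N} B_N(λ₁(ε)) B_N(λ₂(ε)) B_N(λ₃) ⋯ B_N(λ_ℓ) |0⟩_N exists in 𝔥_N. -/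
open Complex Matrix Filter Topology

noncomputable section

/-- The operator on `𝔥_N` acting as `M` on the `k`-th tensor factor. -/
def siteEmb {N : ℕ} (k : Fin N) (M : Matrix (Fin 2) (Fin 2) ℂ) : Matrix (St N) (St N) ℂ :=
  Matrix.of fun x y => ∑ s, if y = Function.update x k s then M (x k) s else 0

lemma siteEmb_mulVec {N : ℕ} (k : Fin N) (M : Matrix (Fin 2) (Fin 2) ℂ) (f : St N → ℂ)
    (x : St N) :
    (siteEmb k M).mulVec f x = ∑ s, M (x k) s * f (Function.update x k s) := by
  simp only [Matrix.mulVec, dotProduct, siteEmb, Matrix.of_apply, Finset.sum_mul]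
  rw [Finset.sum_comm]
  simp [ite_mul]

lemma siteEmb_mul {N : ℕ} (k : Fin N) (M M' : Matrix (Fin 2) (Fin 2) ℂ) :
    siteEmb k M * siteEmb k M' = siteEmb k (M * M') := by
  refine Matrix.ext_iff_mulVec.2 fun f => funext fun x => ?_
  simp only [← Matrix.mulVec_mulVec, siteEmb_mulVec, Function.update_self,
    Function.update_idem, Matrix.mul_apply, Finset.mul_sum, Finset.sum_mul]
  rw [Finset.sum_comm]
  simp only [mul_assoc]

lemma siteEmb_commute {N : ℕ} {j k : Fin N} (h : j ≠ k) (M M' : Matrix (Fin 2) (Fin 2) ℂ) :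
    Commute (siteEmb j M) (siteEmb k M') := by
  refine Matrix.ext_iff_mulVec.2 fun f => funext fun x => ?_
  simp only [← Matrix.mulVec_mulVec, siteEmb_mulVec, Function.update_of_ne h,
    Function.update_of_ne h.symm, Finset.mul_sum]
  rw [Finset.sum_comm]
  refine Finset.sum_congr rfl fun s _ => Finset.sum_congr rfl fun t _ => ?_
  rw [Function.update_comm h]
  ring

lemma siteEmb_add {N : ℕ} (k : Fin N) (M M' : Matrix (Fin 2) (Fin 2) ℂ) :
    siteEmb k (M + M') = siteEmb k M + siteEmb k M' := by
  refine Matrix.ext_iff_mulVec.2 fun f => funext fun x => ?_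
  simp [Matrix.add_mulVec, siteEmb_mulVec, add_mul, Finset.sum_add_distrib]

lemma siteEmb_smul {N : ℕ} (k : Fin N) (r : ℂ) (M : Matrix (Fin 2) (Fin 2) ℂ) :
    siteEmb k (r • M) = r • siteEmb k M := by
  refine Matrix.ext_iff_mulVec.2 fun f => funext fun x => ?_
  simp [Matrix.smul_mulVec, siteEmb_mulVec, mul_assoc, mul_add]

lemma siteOp_eq_siteEmb (N : ℕ) (a : Fin 3) (k : Fin N) :
    siteOp N a k = siteEmb k (pauli a) := by
  ext x y
  have hupd : ∀ s, y = Function.update x k s ↔ s = y k ∧ ∀ j ≠ k, x j = y j := by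
    intro s
    rw [Function.eq_update_iff]
    exact and_congr eq_comm (forall₂_congr fun j _ => eq_comm)
  by_cases h : ∀ j ≠ k, x j = y j
  · have hp : ∏ j ∈ Finset.univ.erase k, (if x j = y j then (1 : ℂ) else 0) = 1 :=
      Finset.prod_eq_one fun j hj => if_pos (h j (Finset.ne_of_mem_erase hj))
    simp only [siteOp, siteEmb, Matrix.of_apply, hupd, hp, mul_one]
    simp [and_iff_left h]
  · have hp : ∏ j ∈ Finset.univ.erase k, (if x j = y j then (1 : ℂ) else 0) = 0 := by
      push Not at h
      obtain ⟨j, hj, hne⟩ := h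
      exact Finset.prod_eq_zero (Finset.mem_erase.2 ⟨hj, Finset.mem_univ j⟩) (if_neg hne)
    simp only [siteOp, siteEmb, Matrix.of_apply, hupd, hp, mul_zero]
    simp [h]

/-- The `(a, b)` block, in the auxiliary space, of an operator on `ℂ² ⊗ 𝔥_N`. -/
def auxBlock {N : ℕ} (M : Matrix (Fin 2 × St N) (Fin 2 × St N) ℂ) (a b : Fin 2) :
    Matrix (St N) (St N) ℂ :=
  Matrix.of fun x y => M (a, x) (b, y)

lemma auxBlock_one {N : ℕ} (a b : Fin 2) :
    auxBlock (1 : Matrix (Fin 2 × St N) (Fin 2 × St N) ℂ) a b = if a = b then 1 else 0 := by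
  ext x y
  by_cases h : a = b <;> simp [auxBlock, Matrix.one_apply, h]

lemma auxBlock_mul {N : ℕ} (M M' : Matrix (Fin 2 × St N) (Fin 2 × St N) ℂ) (a b : Fin 2) :
    auxBlock (M * M') a b = ∑ c, auxBlock M a c * auxBlock M' c b := by
  ext x y
  simp only [auxBlock, Matrix.of_apply, Matrix.mul_apply, Matrix.sum_apply]
  rw [Fintype.sum_prod_type]

/-- The L-operator in terms of the matrix units on the `k`-th factor: up to a shift of the
spectral parameter, it is `i` times the permutation operator. -/
lemma auxBlock_Lop {N : ℕ} (lam : ℂ) (k : Fin N) (a b : Fin 2) :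
    auxBlock (Lop N lam k) a b =
      (if a = b then (lam - Complex.I / 2) • (1 : Matrix (St N) (St N) ℂ) else 0) +
        Complex.I • siteEmb k (Matrix.single b a 1) := by
  have hone : (1 : Matrix (St N) (St N) ℂ) = siteEmb k 1 := by
    refine Matrix.ext_iff_mulVec.2 fun f => funext fun x => ?_
    simp [siteEmb_mulVec, Matrix.one_apply]
  have hblock : auxBlock (Lop N lam k) a b =
      (if a = b then lam • (1 : Matrix (St N) (St N) ℂ) else 0) +
        (Complex.I / 2) • ∑ σ, pauli σ a b • siteOp N σ k := by
    ext x y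
    by_cases h : a = b <;>
      simp [auxBlock, Lop, Matrix.one_apply, Matrix.sum_apply, h]
  rw [hblock]
  simp only [siteOp_eq_siteEmb, Fin.sum_univ_three]
  split_ifs with h <;>
    simp only [hone, ← siteEmb_smul, ← siteEmb_add, zero_add] <;>
    congr 1 <;> fin_cases a <;> fin_cases b <;> simp at h <;> ext s t <;> fin_cases s <;>
    fin_cases t <;> simp [pauli] <;> grind [Complex.I_mul_I]

/-- The constant term of `L(ε + i/2) ⊗ L(ε - i/2)` vanishes on symmetric row vectors. -/
lemma fusion_row {R : Type*} [Ring R] [Algebra ℂ R] (E : Fin 2 → Fin 2 → R)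
    (hE : ∀ a b c d, E a b * E c d = if b = c then E a d else 0)
    (y : Fin 2 → Fin 2 → R) (hy : y 0 1 = y 1 0) (ε : ℂ) (b' d' : Fin 2) :
    ∑ b, ∑ d, y b d * (((if b = b' then ε • (1 : R) else 0) + Complex.I • E b' b) *
        ((if d = d' then (ε - Complex.I) • (1 : R) else 0) + Complex.I • E d' d)) =
      ε • ((ε - Complex.I) • y b' d' +
        Complex.I • ∑ b, (y b d' * E b' b + y b' b * E d' b)) := by
  fin_cases b' <;> fin_cases d' <;>
    simp [Fin.sum_univ_two, mul_add, add_mul, hE, hy, smul_smul] <;>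
    match_scalars <;> grind [Complex.I_mul_I]

lemma auxBlock_prod_commute {N : ℕ} (lam lam' : ℂ) {k : Fin N} :
    ∀ {l : List (Fin N)}, k ∉ l → ∀ a b c d : Fin 2,
      Commute (auxBlock (l.map (Lop N lam)).prod a b) (auxBlock (Lop N lam' k) c d)
  | [], _, a, b, c, d => by
    simp only [List.map_nil, List.prod_nil, auxBlock_one]
    split_ifs
    · exact Commute.one_left _
    · exact Commute.zero_left _
  | j :: l, hk, a, b, c, d => by
    rw [List.mem_cons, not_or] at hk
    have hj : ∀ e, Commute (auxBlock (Lop N lam j) a e) (auxBlock (Lop N lam' k) c d) := by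
      intro e
      simp only [auxBlock_Lop]
      have h := ((siteEmb_commute (Ne.symm hk.1) (Matrix.single e a 1)
        (Matrix.single d c 1)).smul_left Complex.I).smul_right Complex.I
      have hscalar : ∀ (p : Prop) [Decidable p] (z : ℂ) (M : Matrix (St N) (St N) ℂ),
          Commute (if p then z • (1 : Matrix (St N) (St N) ℂ) else 0) M := by
        intro p _ z M
        split_ifs
        · exact (Commute.one_left M).smul_left z
        · exact Commute.zero_left M
      exact (hscalar _ _ _).add_left ((hscalar _ _ _).symm.add_right h)
    rw [List.map_cons, List.prod_cons, auxBlock_mul]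
    exact Commute.sum_left _ _ _ fun e _ =>
      (hj e).mul_left (auxBlock_prod_commute lam lam' hk.2 e b c d)

/-- At spectral parameters differing by `i`, the first row of the fused monodromy matrix over a
list of distinct sites is divisible by `ε` to the number of sites. -/
lemma exists_fused_row {N : ℕ} (l : List (Fin N)) (hl : l.Nodup) :
    ∃ y : Fin 2 → Fin 2 → ℂ → Matrix (St N) (St N) ℂ,
      (∀ b d, Continuous (y b d)) ∧ y 0 1 = y 1 0 ∧
      ∀ ε b d, auxBlock (l.map (Lop N (Complex.I / 2 + ε))).prod 0 b *
        auxBlock (l.map (Lop N (-(Complex.I / 2) + ε))).prod 0 d = ε ^ l.length • y b d ε := by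
  induction l using List.reverseRecOn with
  | nil =>
    refine ⟨fun b d _ => if b = 0 ∧ d = 0 then 1 else 0, fun b d => continuous_const, ?_, ?_⟩
    · simp
    · intro ε b d
      fin_cases b <;> fin_cases d <;> simp [auxBlock_one]
  | append_singleton l k ih =>
    obtain ⟨hl', hk⟩ : l.Nodup ∧ k ∉ l := by
      rw [List.nodup_append] at hl
      exact ⟨hl.1, fun h => hl.2.2 k h k (by simp) rfl⟩
    obtain ⟨y, hyc, hys, hy⟩ := ih hl'
    set E : Fin 2 → Fin 2 → Matrix (St N) (St N) ℂ :=
      fun a b => siteEmb k (Matrix.single a b 1) with hEdef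
    have hE : ∀ a b c d, E a b * E c d = if b = c then E a d else 0 := by
      intro a b c d
      simp only [hEdef, siteEmb_mul]
      split_ifs with h
      · simp [h]
      · rw [Matrix.single_mul_single_of_ne _ _ _ _ h]
        simpa using siteEmb_smul k 0 0
    refine ⟨fun b' d' ε => (ε - Complex.I) • y b' d' ε +
        Complex.I • ∑ b, (y b d' ε * E b' b + y b' b ε * E d' b), ?_, ?_, ?_⟩
    · intro b d
      fun_prop
    · funext ε
      have h1 : y 0 1 ε = y 1 0 ε := congrFun hys ε
      simp only [Fin.sum_univ_two, h1]
      module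
    · intro ε b' d'
      have hu : ∀ b, auxBlock (Lop N (Complex.I / 2 + ε) k) b b' =
          (if b = b' then ε • (1 : Matrix (St N) (St N) ℂ) else 0) + Complex.I • E b' b := by
        intro b
        rw [auxBlock_Lop, add_sub_cancel_left]
      have hv : ∀ d, auxBlock (Lop N (-(Complex.I / 2) + ε) k) d d' =
          (if d = d' then (ε - Complex.I) • (1 : Matrix (St N) (St N) ℂ) else 0) +
            Complex.I • E d' d := by
        intro d
        rw [auxBlock_Lop, show -(Complex.I / 2) + ε - Complex.I / 2 = ε - Complex.I by ring]
      rw [List.length_append, List.length_singleton, pow_succ, mul_smul,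
        ← fusion_row E hE (fun b d => y b d ε) (congrFun hys ε) ε b' d']
      simp only [List.map_append, List.map_singleton, List.prod_append, List.prod_singleton,
        auxBlock_mul, Finset.sum_mul_sum, Finset.smul_sum]
      refine Finset.sum_congr rfl fun b _ => Finset.sum_congr rfl fun d _ => ?_
      rw [← hu, ← hv, ← smul_mul_assoc, ← hy]
      have hc := (auxBlock_prod_commute (-(Complex.I / 2) + ε) (Complex.I / 2 + ε) hk
        0 d b b').eq
      simp only [mul_assoc]
      rw [← mul_assoc (auxBlock (Lop N _ k) b b'), ← hc]
      simp only [mul_assoc]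

lemma continuous_Lop {N : ℕ} (k : Fin N) : Continuous fun lam => Lop N lam k := by
  unfold Lop
  fun_prop

lemma continuous_prod_Lop {N : ℕ} (l : List (Fin N)) :
    Continuous fun lam => (l.map (Lop N lam)).prod :=
  continuous_list_prod l fun k _ => continuous_Lop k

lemma exists_prod_Lop_add {N : ℕ} (l : List (Fin N)) :
    ∃ G : ℂ → ℂ → Matrix (Fin 2 × St N) (Fin 2 × St N) ℂ,
      Continuous (fun p : ℂ × ℂ => G p.1 p.2) ∧
      ∀ z h, (l.map (Lop N (z + h))).prod = (l.map (Lop N z)).prod + h • G z h := by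
  induction l with
  | nil => exact ⟨fun _ _ => 0, continuous_const, by simp⟩
  | cons k l ih =>
    obtain ⟨G, hG, hGe⟩ := ih
    have hT := continuous_prod_Lop l
    have hL := continuous_Lop k
    refine ⟨fun z h => Lop N z k * G z h + (l.map (Lop N (z + h))).prod, ?_, fun z h => ?_⟩
    · exact ((hL.comp continuous_fst).mul hG).add
        (hT.comp (continuous_fst.add continuous_snd))
    · have hLe : Lop N (z + h) k = Lop N z k + h • 1 := by
        simp only [Lop, add_smul]
        abel
      simp only [List.map_cons, List.prod_cons]
      rw [hLe, add_mul, smul_mul_assoc, one_mul, smul_add, ← add_assoc]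
      congr 1
      rw [hGe, mul_add, mul_smul_comm]

lemma continuous_auxBlock {N : ℕ} (a b : Fin 2) : Continuous fun M => auxBlock (N := N) M a b := by
  unfold auxBlock
  fun_prop

/-- Existence of the Nepomechie–Wang limit
`Ψ = lim_{ε→0} ε^{−N} B_N(λ₁(ε)) B_N(λ₂(ε)) B_N(λ₃) ⋯ B_N(λ_ℓ) |0⟩_N`. -/
theorem nw_limit_exists (N : ℕ) (hN : 2 ≤ N) {m : ℕ} (mu : Fin m → ℂ)
    (hinj : Function.Injective mu)
    (hp : ∀ j, mu j ≠ Complex.I / 2) (hm : ∀ j, mu j ≠ -(Complex.I / 2))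
    (c : ℂ)
    (hc1 : c = -(2 / Complex.I ^ (N + 1)) *
      ∏ j, (mu j - 3 * Complex.I / 2) / (mu j + Complex.I / 2))
    (hc2 : c = 2 * Complex.I ^ (N + 1) *
      ∏ j, (mu j + 3 * Complex.I / 2) / (mu j - Complex.I / 2)) :
    ∃ Ψ : St N → ℂ, Tendsto
      (fun eps : ℂ => (eps ^ N)⁻¹ •
        (Bop N (nwLam1 N c eps) * Bop N (nwLam2 eps) *
          ((List.finRange m).map fun j => Bop N (mu j)).prod).mulVec (vac N))
      (𝓝[≠] (0 : ℂ)) (𝓝 Ψ) := by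
  obtain ⟨y, hyc, -, hy⟩ :=
    exists_fused_row (List.finRange N).reverse (List.nodup_reverse.2 (List.nodup_finRange N))
  obtain ⟨G, hG, hGe⟩ := exists_prod_Lop_add (List.finRange N).reverse
  have hB : ∀ z, Bop N z = auxBlock ((List.finRange N).reverse.map (Lop N z)).prod 0 1 :=
    fun _ => rfl
  have hBB : ∀ ε, Bop N (nwLam1 N c ε) * Bop N (nwLam2 ε) = ε ^ N • (y 1 1 ε +
      c • (auxBlock (G (Complex.I / 2 + ε) (c * ε ^ N)) 0 1 * Bop N (nwLam2 ε))) := by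
    intro ε
    have h1 : Bop N (nwLam1 N c ε) = Bop N (Complex.I / 2 + ε) +
        (c * ε ^ N) • auxBlock (G (Complex.I / 2 + ε) (c * ε ^ N)) 0 1 := by
      rw [hB, hB, nwLam1, hGe]
      rfl
    have h2 : Bop N (Complex.I / 2 + ε) * Bop N (nwLam2 ε) = ε ^ N • y 1 1 ε := by
      simpa [nwLam2, hB] using hy ε 1 1
    rw [h1, add_mul, h2, smul_add, smul_mul_assoc, smul_smul, mul_comm c]
  have hcont : Continuous fun ε => ((y 1 1 ε +
      c • (auxBlock (G (Complex.I / 2 + ε) (c * ε ^ N)) 0 1 * Bop N (nwLam2 ε))) *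
        ((List.finRange m).map fun j => Bop N (mu j)).prod).mulVec (vac N) := by
    have hGc : Continuous fun ε => auxBlock (G (Complex.I / 2 + ε) (c * ε ^ N)) 0 1 :=
      (continuous_auxBlock 0 1).comp <| hG.comp
        (f := fun ε : ℂ => (Complex.I / 2 + ε, c * ε ^ N)) (by fun_prop)
    have hBc : Continuous fun ε => Bop N (nwLam2 ε) :=
      ((continuous_auxBlock 0 1).comp (continuous_prod_Lop (List.finRange N).reverse)).comp
        (continuous_const.add continuous_id)
    have hyc' := hyc 1 1
    exact Continuous.matrix_mulVec (by fun_prop) continuous_const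
  refine ⟨_, (hcont.continuousAt.tendsto.mono_left nhdsWithin_le_nhds).congr' ?_⟩
  filter_upwards [self_mem_nhdsWithin] with ε hε
  rw [hBB, smul_mul_assoc, Matrix.smul_mulVec, smul_smul,
    inv_mul_cancel₀ (pow_ne_zero N hε), one_smul]
end
end

section
/- Let N ≥ 3, J ∈ ℝ, and let λ₃, …, λ_ℓ ∈ ℂ be pairwise distinct with λ_j ∉ {i/2, −i/2, 3i/2, −3i/2} and λ_k − λ_j ≠ i for all j ≠ k, such that (i/2, −i/2, λ₃, …, λ_ℓ) satisfies the Bethe ansatz equations for k = 3, …, ℓ, and suppose c ∈ ℂ satisfies both c = −(2/i^{N+1}) ∏_{j=3}^{ℓ} (λ_j − 3i/2)/(λ_j + i/2) and c = 2 i^{N+1} ∏_{j=3}^{ℓ} (λ_j + 3i/2)/(λ_j − i/2). Then the vector Ψ = lim_{ε→0} ε^{−N} B_N(λ₁(ε)) B_N(λ₂(ε)) B_N(λ₃) ⋯ B_N(λ_ℓ) |0⟩_N satisfies ℋ_N Ψ = ℰ Ψ for some ℰ ∈ ℂ. -/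
open Complex Matrix Filter Topology

noncomputable section

/-! ### Operators on the tensor product -/

/-- Operators on `𝔥_N`. -/
abbrev Op (N : ℕ) := Matrix (St N) (St N) ℂ

/-- The tensor product `F₁ ⊗ ⋯ ⊗ F_N` of one-site operators. -/
def tensorHom (N : ℕ) : (Fin N → Matrix (Fin 2) (Fin 2) ℂ) →* Op N where
  toFun F := Matrix.of fun x y => ∏ j, F j (x j) (y j)
  map_one' := by
    ext x y
    simp only [Pi.one_apply, Matrix.one_apply, Matrix.of_apply, funext_iff]
    by_cases h : ∀ j, x j = y j
    · simp [h]
    · obtain ⟨j, hj⟩ := not_forall.mp h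
      rw [if_neg h]
      exact Finset.prod_eq_zero (Finset.mem_univ j) (if_neg hj)
  map_mul' F G := by
    ext x y
    simp only [Pi.mul_apply, Matrix.mul_apply, Matrix.of_apply, Fintype.prod_sum,
      Finset.prod_mul_distrib]

/-- The one-site operator `M` acting on the `k`-th tensor factor. -/
def siteHom {N : ℕ} (k : Fin N) : Matrix (Fin 2) (Fin 2) ℂ →* Op N :=
  (tensorHom N).comp (MonoidHom.mulSingle (fun _ => Matrix (Fin 2) (Fin 2) ℂ) k)

theorem siteHom_apply {N : ℕ} (k : Fin N) (M : Matrix (Fin 2) (Fin 2) ℂ) (x y : St N) :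
    siteHom k M x y =
      M (x k) (y k) * ∏ j ∈ Finset.univ.erase k, (if x j = y j then (1 : ℂ) else 0) := by
  simp only [siteHom, tensorHom, MonoidHom.comp_apply, MonoidHom.mulSingle_apply,
    MonoidHom.coe_mk, OneHom.coe_mk, Matrix.of_apply]
  rw [← Finset.mul_prod_erase _ _ (Finset.mem_univ k), Pi.mulSingle_eq_same]
  congr 1
  refine Finset.prod_congr rfl fun j hj => ?_
  rw [Pi.mulSingle_eq_of_ne (Finset.ne_of_mem_erase hj), Matrix.one_apply]

theorem siteHom_add {N : ℕ} (k : Fin N) (M M' : Matrix (Fin 2) (Fin 2) ℂ) :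
    siteHom k (M + M') = siteHom k M + siteHom k M' := by
  ext x y
  simp [siteHom_apply, add_mul]

theorem siteHom_smul {N : ℕ} (k : Fin N) (c : ℂ) (M : Matrix (Fin 2) (Fin 2) ℂ) :
    siteHom k (c • M) = c • siteHom k M := by
  ext x y
  simp [siteHom_apply, mul_assoc]

theorem siteHom_zero {N : ℕ} (k : Fin N) : siteHom k 0 = 0 := by
  ext x y
  simp [siteHom_apply]

theorem siteHom_commute {N : ℕ} {k k' : Fin N} (h : k ≠ k') (M M' : Matrix (Fin 2) (Fin 2) ℂ) :
    Commute (siteHom k M) (siteHom k' M') :=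
  Commute.map (Pi.mulSingle_commute (f := fun _ => Matrix (Fin 2) (Fin 2) ℂ) h M M') (tensorHom N)

theorem siteOp_eq_siteHom {N : ℕ} (a : Fin 3) (k : Fin N) :
    siteOp N a k = siteHom k (pauli a) := by
  ext x y
  rw [siteHom_apply]
  rfl

/-- The matrix unit `E_{ab}` acting on the `k`-th tensor factor. -/
def unitOp {N : ℕ} (k : Fin N) (a b : Fin 2) : Op N := siteHom k (Matrix.single a b 1)

theorem unitOp_mul {N : ℕ} (k : Fin N) (a b c d : Fin 2) :
    unitOp k a b * unitOp k c d = if b = c then unitOp k a d else 0 := by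
  rw [unitOp, unitOp, ← map_mul]
  split_ifs with h
  · subst h
    rw [Matrix.single_mul_single_same, one_mul, unitOp]
  · rw [Matrix.single_mul_single_of_ne _ _ _ _ h, siteHom_zero]

theorem unitOp_sum {N : ℕ} (k : Fin N) : unitOp k 0 0 + unitOp k 1 1 = 1 := by
  rw [unitOp, unitOp, ← siteHom_add, ← map_one (siteHom k)]
  congr 1
  ext a b
  fin_cases a <;> fin_cases b <;> simp

theorem unitOp_commute {N : ℕ} {k k' : Fin N} (h : k ≠ k') (a b c d : Fin 2) :
    Commute (unitOp k a b) (unitOp k' c d) :=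
  siteHom_commute h _ _

theorem siteHom_eq_unitOp {N : ℕ} (k : Fin N) (M : Matrix (Fin 2) (Fin 2) ℂ) :
    siteHom k M = M 0 0 • unitOp k 0 0 + M 0 1 • unitOp k 0 1 + M 1 0 • unitOp k 1 0 +
      M 1 1 • unitOp k 1 1 := by
  simp only [unitOp, ← siteHom_smul, ← siteHom_add]
  congr 1
  ext a b
  fin_cases a <;> fin_cases b <;> simp

theorem unitOp_mulVec_vac {N : ℕ} (k : Fin N) (a b : Fin 2) (hab : a = 0 ∨ b ≠ 0) :
    (unitOp k a b).mulVec (vac N) = if a = b then (if a = 0 then vac N else 0) else 0 := by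
  have key : (unitOp k a b).mulVec (vac N) = fun x => unitOp k a b x (fun _ => 0) := by
    ext x
    simp [Matrix.mulVec, dotProduct, vac]
  rw [key]
  ext x
  simp only [unitOp, siteHom_apply]
  by_cases hb : b = 0
  · have ha : a = 0 := hab.resolve_right (not_not.mpr hb)
    subst ha hb
    simp only [vac, if_true, funext_iff]
    by_cases h : ∀ j, x j = 0
    · simp [h]
    · rw [if_neg h]
      obtain ⟨j, hj⟩ := not_forall.mp h
      by_cases hjk : j = k
      · subst hjk
        simp [Ne.symm hj]
      · rw [Finset.prod_eq_zero (Finset.mem_erase.mpr ⟨hjk, Finset.mem_univ j⟩) (if_neg hj),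
          mul_zero]
  · simp only [Matrix.single_apply, hb, and_false, if_false, zero_mul]
    split_ifs with h1 h2
    · exact absurd (h1 ▸ h2) hb
    · rfl
    · rfl

/-! ### The monodromy matrix over the operator ring -/

/-- The L-operator `L_k(u + i/2)`, as a `2 × 2` matrix of operators on `𝔥_N`. -/
def Lmat {N : ℕ} (u : ℂ) (k : Fin N) : Matrix (Fin 2) (Fin 2) (Op N) :=
  Matrix.of fun a b => (if a = b then u • (1 : Op N) else 0) + Complex.I • unitOp k b a

/-- The product of the L-operators `L_k(u + i/2)` over the list `s` of sites. -/
def Tmat {N : ℕ} (s : List (Fin N)) (u : ℂ) : Matrix (Fin 2) (Fin 2) (Op N) :=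
  (s.map (Lmat u)).prod

theorem Tmat_cons {N : ℕ} (k : Fin N) (s : List (Fin N)) (u : ℂ) :
    Tmat (k :: s) u = Lmat u k * Tmat s u := by
  simp [Tmat]

theorem Tmat_append {N : ℕ} (s t : List (Fin N)) (u : ℂ) :
    Tmat (s ++ t) u = Tmat s u * Tmat t u := by
  simp [Tmat]

theorem compRingEquiv_Lmat {N : ℕ} (lam : ℂ) (k : Fin N) :
    Matrix.compRingEquiv (Fin 2) (St N) ℂ (Lmat (lam - Complex.I / 2) k) = Lop N lam k := by
  have h1 (x y : St N) : (1 : Op N) x y = unitOp k 0 0 x y + unitOp k 1 1 x y := by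
    rw [← unitOp_sum k]; rfl
  ext ⟨a, x⟩ ⟨b, y⟩
  simp only [Lop, siteOp_eq_siteHom, siteHom_eq_unitOp, Fin.sum_univ_three, Matrix.add_apply,
    Matrix.smul_apply, Matrix.of_apply, Matrix.one_apply, Prod.mk.injEq]
  change Lmat (lam - Complex.I / 2) k a b x y = _
  have h2 : (if x = y then (1 : ℂ) else 0) = unitOp k 0 0 x y + unitOp k 1 1 x y := by
    rw [← h1, Matrix.one_apply]
  simp only [Lmat, Matrix.of_apply, Matrix.add_apply, Matrix.smul_apply]
  fin_cases a <;> fin_cases b <;> simp [pauli, h1, h2] <;> ring_nf <;> simp <;> ring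

theorem monodromy_apply {N : ℕ} (lam : ℂ) (a b : Fin 2) (x y : St N) :
    monodromy N lam (a, x) (b, y) =
      Tmat (List.finRange N).reverse (lam - Complex.I / 2) a b x y := by
  have h : monodromy N lam = Matrix.compRingEquiv (Fin 2) (St N) ℂ
      (Tmat (List.finRange N).reverse (lam - Complex.I / 2)) := by
    rw [Tmat, map_list_prod, List.map_map, monodromy]
    congr 2
    ext1 k
    exact (compRingEquiv_Lmat lam k).symm
  rw [h]
  rfl

/-! ### The RTT relation -/

theorem Lmat_apply {N : ℕ} (u : ℂ) (k : Fin N) (a b : Fin 2) :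
    Lmat u k a b = (if a = b then u • (1 : Op N) else 0) + Complex.I • unitOp k b a := rfl

theorem Lmat_commute_unitOp {N : ℕ} {k k' : Fin N} (h : k ≠ k') (u : ℂ) (a b c d : Fin 2) :
    Commute (unitOp k c d) (Lmat u k' a b) := by
  rw [Lmat_apply]
  refine Commute.add_right ?_ ((unitOp_commute h _ _ _ _).smul_right _)
  split_ifs
  · exact (Commute.one_right _).smul_right _
  · exact Commute.zero_right _

theorem Lmat_commute_Lmat {N : ℕ} {k k' : Fin N} (h : k ≠ k') (u v : ℂ) (a b c d : Fin 2) :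
    Commute (Lmat u k a b) (Lmat v k' c d) := by
  rw [Lmat_apply]
  refine Commute.add_left ?_ ((Lmat_commute_unitOp h _ _ _ _ _).smul_left _)
  split_ifs
  · exact (Commute.one_left _).smul_left _
  · exact Commute.zero_left _

theorem commute_Tmat {N : ℕ} (x : Op N) (s : List (Fin N)) (v : ℂ)
    (h : ∀ k ∈ s, ∀ c d, Commute x (Lmat v k c d)) (c d : Fin 2) : Commute x (Tmat s v c d) := by
  induction s generalizing c with
  | nil =>
    rw [Tmat, List.map_nil, List.prod_nil, Matrix.one_apply]
    split_ifs
    · exact Commute.one_right _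
    · exact Commute.zero_right _
  | cons j s ih =>
    rw [Tmat_cons, Matrix.mul_apply]
    exact Commute.sum_right _ _ _ fun e _ => (h j (by simp) c e).mul_right
      (ih (fun k hk => h k (by simp [hk])) e)

theorem Lmat_commute_Tmat {N : ℕ} {k : Fin N} {s : List (Fin N)} (h : k ∉ s) (u v : ℂ)
    (a b c d : Fin 2) : Commute (Lmat u k a b) (Tmat s v c d) :=
  commute_Tmat _ s v (fun _ hj _ _ => Lmat_commute_Lmat (ne_of_mem_of_not_mem hj h).symm _ _ _ _ _ _)
    c d

theorem Tmat_commute_Tmat {N : ℕ} {s t : List (Fin N)} (h : s.Disjoint t) (u v : ℂ)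
    (a b c d : Fin 2) : Commute (Tmat s u a b) (Tmat t v c d) :=
  (commute_Tmat _ s u (fun _ hj _ _ => (Lmat_commute_Tmat (h hj) _ _ _ _ _ _).symm) a b).symm

section Kronecker

variable {R : Type*} [Ring R]

/-- The product `X₁ Y₂` of operators on two auxiliary spaces. -/
def kron (X Y : Matrix (Fin 2) (Fin 2) R) : Matrix (Fin 2 × Fin 2) (Fin 2 × Fin 2) R :=
  Matrix.of fun p q => X p.1 q.1 * Y p.2 q.2

/-- The product `Y₂ X₁` of operators on two auxiliary spaces. -/
def kronRev (X Y : Matrix (Fin 2) (Fin 2) R) : Matrix (Fin 2 × Fin 2) (Fin 2 × Fin 2) R :=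
  Matrix.of fun p q => Y p.2 q.2 * X p.1 q.1

theorem kron_mul (X X' Y Y' : Matrix (Fin 2) (Fin 2) R)
    (h : ∀ a b c d, Commute (X' a b) (Y c d)) :
    kron (X * X') (Y * Y') = kron X Y * kron X' Y' := by
  ext p q
  simp only [kron, Matrix.of_apply, Matrix.mul_apply, Fintype.sum_prod_type, Finset.sum_mul_sum]
  refine Finset.sum_congr rfl fun e _ => Finset.sum_congr rfl fun f _ => ?_
  rw [mul_assoc, mul_assoc, (h _ _ _ _).left_comm]

theorem kronRev_mul (X X' Y Y' : Matrix (Fin 2) (Fin 2) R)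
    (h : ∀ a b c d, Commute (Y' a b) (X c d)) :
    kronRev (X * X') (Y * Y') = kronRev X Y * kronRev X' Y' := by
  ext p q
  simp only [kronRev, Matrix.of_apply, Matrix.mul_apply, Fintype.sum_prod_type,
    Finset.sum_mul_sum]
  rw [Finset.sum_comm]
  refine Finset.sum_congr rfl fun e _ => Finset.sum_congr rfl fun f _ => ?_
  rw [mul_assoc, mul_assoc, (h _ _ _ _).left_comm]

/-- The permutation of the two auxiliary spaces. -/
def swapMat (R : Type*) [Ring R] : Matrix (Fin 2 × Fin 2) (Fin 2 × Fin 2) R :=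
  Matrix.of fun p q => if p.swap = q then 1 else 0

theorem swapMat_mul_apply (K : Matrix (Fin 2 × Fin 2) (Fin 2 × Fin 2) R) (p q : Fin 2 × Fin 2) :
    (swapMat R * K) p q = K p.swap q := by
  simp [swapMat, Matrix.mul_apply]

theorem mul_swapMat_apply (K : Matrix (Fin 2 × Fin 2) (Fin 2 × Fin 2) R) (p q : Fin 2 × Fin 2) :
    (K * swapMat R) p q = K p q.swap := by
  simp only [swapMat, Matrix.mul_apply, Matrix.of_apply, Prod.swap_eq_iff_eq_swap, mul_ite, mul_one,
    mul_zero, Finset.sum_ite_eq', Finset.mem_univ, if_true]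

theorem swapMat_mul_self : swapMat R * swapMat R = 1 := by
  ext p q
  rw [swapMat_mul_apply, swapMat, Matrix.of_apply, Prod.swap_swap, Matrix.one_apply]

end Kronecker

/-- The rational R-matrix `r + i P`. -/
def Rmat (N : ℕ) (r : ℂ) : Matrix (Fin 2 × Fin 2) (Fin 2 × Fin 2) (Op N) :=
  r • 1 + Complex.I • swapMat (Op N)

theorem semiconjBy_Lmat {N : ℕ} (k : Fin N) (u v : ℂ) :
    SemiconjBy (Rmat N (u - v)) (kron (Lmat u k) (Lmat v k)) (kronRev (Lmat u k) (Lmat v k)) := by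
  rw [SemiconjBy, Rmat, add_mul, mul_add, smul_mul_assoc, smul_mul_assoc, mul_smul_comm,
    mul_smul_comm, one_mul, mul_one]
  refine Matrix.ext fun ⟨a, c⟩ ⟨b, d⟩ => ?_
  rw [Matrix.add_apply, Matrix.add_apply, Matrix.smul_apply, Matrix.smul_apply, Matrix.smul_apply,
    Matrix.smul_apply, swapMat_mul_apply, mul_swapMat_apply]
  simp only [kron, kronRev, Matrix.of_apply, Prod.swap_prod_mk, Lmat_apply]
  fin_cases a <;> fin_cases b <;> fin_cases c <;> fin_cases d <;>
    simp [add_mul, mul_add, unitOp_mul] <;> module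

theorem semiconjBy_Tmat {N : ℕ} {s : List (Fin N)} (hs : s.Nodup) (u v : ℂ) :
    SemiconjBy (Rmat N (u - v)) (kron (Tmat s u) (Tmat s v)) (kronRev (Tmat s u) (Tmat s v)) := by
  induction s with
  | nil =>
    have h1 : kron (1 : Matrix (Fin 2) (Fin 2) (Op N)) 1 = 1 := by
      refine Matrix.ext fun ⟨a, c⟩ ⟨b, d⟩ => ?_
      simp [kron, Matrix.one_apply, ← ite_and, and_comm]
    have h2 : kronRev (1 : Matrix (Fin 2) (Fin 2) (Op N)) 1 = 1 := by
      refine Matrix.ext fun ⟨a, c⟩ ⟨b, d⟩ => ?_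
      simp [kronRev, Matrix.one_apply, ← ite_and]
    simp only [Tmat, List.map_nil, List.prod_nil, h1, h2]
    exact SemiconjBy.one_right _
  | cons k s ih =>
    rw [List.nodup_cons] at hs
    rw [Tmat_cons, Tmat_cons,
      kron_mul _ _ _ _ fun a b c d => (Lmat_commute_Tmat hs.1 _ _ _ _ _ _).symm,
      kronRev_mul _ _ _ _ fun a b c d => (Lmat_commute_Tmat hs.1 _ _ _ _ _ _).symm]
    exact (semiconjBy_Lmat k u v).mul_right (ih hs.2)

/-- The RTT relation in components. -/
theorem Tmat_rtt {N : ℕ} {s : List (Fin N)} (hs : s.Nodup) (u v : ℂ) (a b c d : Fin 2) :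
    (u - v) • (Tmat s u a b * Tmat s v c d) + Complex.I • (Tmat s u c b * Tmat s v a d) =
      (u - v) • (Tmat s v c d * Tmat s u a b) + Complex.I • (Tmat s v c b * Tmat s u a d) := by
  have h := congrFun (congrFun (semiconjBy_Tmat hs u v).eq (a, c)) (b, d)
  rw [Rmat, add_mul, mul_add, smul_mul_assoc, smul_mul_assoc, mul_smul_comm, mul_smul_comm,
    one_mul, mul_one, Matrix.add_apply, Matrix.add_apply, Matrix.smul_apply, Matrix.smul_apply,
    Matrix.smul_apply, Matrix.smul_apply, swapMat_mul_apply, mul_swapMat_apply] at h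
  exact h

/-! ### Fusion: divisibility of `B(i/2 + ε) B(-i/2 + ε)` by `ε ^ N` -/

/-- Twice the projection onto the symmetric part of the two auxiliary spaces. -/
def symMat (N : ℕ) : Matrix (Fin 2 × Fin 2) (Fin 2 × Fin 2) (Op N) := 1 + swapMat (Op N)

theorem symMat_mul_self (N : ℕ) : symMat N * symMat N = (2 : ℂ) • symMat N := by
  rw [symMat, add_mul, mul_add, mul_add, swapMat_mul_self, one_mul, one_mul, mul_one]
  module

theorem symMat_mul_kron_Lmat {N : ℕ} (k : Fin N) :
    ∃ Q : ℂ → Matrix (Fin 2 × Fin 2) (Fin 2 × Fin 2) (Op N), Continuous Q ∧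
      ∀ e, symMat N * kron (Lmat e k) (Lmat (e - Complex.I) k) = e • Q e := by
  refine ⟨fun e => Matrix.of fun p q =>
    (if p.1 = q.1 then Lmat (e - Complex.I) k p.2 q.2 else 0) +
    (if p.2 = q.2 then Complex.I • unitOp k q.1 p.1 else 0) +
    (if p.2 = q.1 then Lmat (e - Complex.I) k p.1 q.2 else 0) +
    (if p.1 = q.2 then Complex.I • unitOp k q.1 p.2 else 0), ?_, fun e => ?_⟩
  · refine continuous_matrix fun p q => ?_
    simp only [Matrix.of_apply, Lmat_apply]
    split_ifs <;> fun_prop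
  · rw [symMat, add_mul, one_mul]
    refine Matrix.ext fun ⟨a, c⟩ ⟨b, d⟩ => ?_
    rw [Matrix.add_apply, Matrix.smul_apply, swapMat_mul_apply]
    simp only [kron, Matrix.of_apply, Prod.swap_prod_mk, Lmat_apply]
    fin_cases a <;> fin_cases b <;> fin_cases c <;> fin_cases d <;>
      simp [add_mul, mul_add, unitOp_mul] <;> module

theorem symMat_mul_kron_Tmat {N : ℕ} {s : List (Fin N)} (hs : s.Nodup) :
    ∃ Q : ℂ → Matrix (Fin 2 × Fin 2) (Fin 2 × Fin 2) (Op N), Continuous Q ∧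
      ∀ e, symMat N * kron (Tmat s e) (Tmat s (e - Complex.I)) = e ^ s.length • Q e := by
  induction s with
  | nil => exact ⟨fun _ => symMat N * kron 1 1, continuous_const, fun e => by simp [Tmat]⟩
  | cons k s ih =>
    rw [List.nodup_cons] at hs
    obtain ⟨Q, hQ, hQe⟩ := ih hs.2
    obtain ⟨Q', hQ', hQe'⟩ := symMat_mul_kron_Lmat k
    refine ⟨fun e => (1 / 2 : ℂ) • (Q' e * Q e),
      (hQ'.matrix_mul hQ).const_smul (1 / 2 : ℂ), fun e => ?_⟩
    rw [Tmat_cons, Tmat_cons,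
      kron_mul _ _ _ _ fun a b c d => (Lmat_commute_Tmat hs.1 _ _ _ _ _ _).symm]
    have hsc := (semiconjBy_Lmat k e (e - Complex.I)).eq
    have hR : Rmat N (e - (e - Complex.I)) = Complex.I • symMat N := by
      rw [Rmat, symMat, sub_sub_cancel, smul_add]
    rw [hR, smul_mul_assoc, mul_smul_comm] at hsc
    replace hsc := smul_right_injective _ Complex.I_ne_zero hsc
    set K := kron (Lmat e k) (Lmat (e - Complex.I) k) with hK
    have h2 : symMat N * K * symMat N = (2 : ℂ) • (symMat N * K) := by
      rw [hsc, mul_assoc, symMat_mul_self, mul_smul_comm]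
    have h3 : symMat N * K = (1 / 2 : ℂ) • (symMat N * K * symMat N) := by
      rw [h2, smul_smul]
      norm_num
    rw [← mul_assoc, h3, smul_mul_assoc, mul_assoc _ (symMat N), hQe, hQe', List.length_cons,
      pow_succ', smul_mul_smul_comm, smul_comm]

theorem Tmat_mul_Tmat_fusion {N : ℕ} {s : List (Fin N)} (hs : s.Nodup) :
    ∃ Q : ℂ → Op N, Continuous Q ∧
      ∀ e, Tmat s e 0 1 * Tmat s (e - Complex.I) 0 1 = e ^ s.length • Q e := by
  obtain ⟨Q, hQ, hQe⟩ := symMat_mul_kron_Tmat hs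
  refine ⟨fun e => (1 / 2 : ℂ) • Q e (0, 0) (1, 1),
    (hQ.matrix_elem _ _).const_smul (1 / 2 : ℂ), fun e => ?_⟩
  have h := congrFun (congrFun (hQe e) (0, 0)) (1, 1)
  rw [symMat, add_mul, one_mul, Matrix.add_apply, swapMat_mul_apply, Matrix.smul_apply] at h
  simp only [kron, Matrix.of_apply, Prod.swap_prod_mk] at h
  rw [smul_comm, ← h, ← two_smul ℂ, smul_smul]
  norm_num

/-! ### The algebraic Bethe ansatz -/

theorem Tmat_mulVec_vac {N : ℕ} {s : List (Fin N)} (hs : s.Nodup) (u : ℂ) :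
    (Tmat s u 1 0).mulVec (vac N) = 0 ∧
      (Tmat s u 0 0).mulVec (vac N) = (u + Complex.I) ^ s.length • vac N ∧
      (Tmat s u 1 1).mulVec (vac N) = u ^ s.length • vac N := by
  induction s with
  | nil => simp [Tmat]
  | cons k s ih =>
    rw [List.nodup_cons] at hs
    obtain ⟨h10, h00, h11⟩ := ih hs.2
    have l10 : (Lmat u k 1 0).mulVec (vac N) = 0 := by
      simp [Lmat_apply, Matrix.smul_mulVec, unitOp_mulVec_vac]
    have l00 : (Lmat u k 0 0).mulVec (vac N) = (u + Complex.I) • vac N := by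
      simp [Lmat_apply, Matrix.smul_mulVec, Matrix.add_mulVec, unitOp_mulVec_vac, add_smul]
    have l11 : (Lmat u k 1 1).mulVec (vac N) = u • vac N := by
      simp [Lmat_apply, Matrix.smul_mulVec, Matrix.add_mulVec, unitOp_mulVec_vac]
    have hc := (Lmat_commute_Tmat hs.1 u u 1 0 0 1).eq
    simp only [Tmat_cons, Matrix.mul_apply, Fin.sum_univ_two, Matrix.add_mulVec,
      List.length_cons, pow_succ]
    rw [hc]
    simp only [← Matrix.mulVec_mulVec, h10, h00, h11, l10, Matrix.mulVec_smul, l00, l11,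
      Matrix.mulVec_zero, smul_zero, add_zero, zero_add, smul_smul, and_self]

theorem Tmat_01_commute {N : ℕ} {s : List (Fin N)} (hs : s.Nodup) (u v : ℂ) :
    Commute (Tmat s u 0 1) (Tmat s v 0 1) := by
  have key : ∀ u v : ℂ, u - v + Complex.I ≠ 0 → Commute (Tmat s u 0 1) (Tmat s v 0 1) := by
    intro u v h
    have h1 := Tmat_rtt hs u v 0 1 0 1
    rw [← add_smul, ← add_smul] at h1
    exact smul_right_injective _ h h1
  by_cases h : u - v + Complex.I = 0
  · refine (key v u fun h' => ?_).symm
    have h2 : (2 : ℂ) * Complex.I = 0 := by linear_combination h + h'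
    simp at h2
  · exact key u v h

theorem Tmat_00_mul_01 {N : ℕ} {s : List (Fin N)} (hs : s.Nodup) {u v : ℂ} (h : u ≠ v) :
    Tmat s u 0 0 * Tmat s v 0 1 = (1 - Complex.I / (u - v)) • (Tmat s v 0 1 * Tmat s u 0 0) +
      (Complex.I / (u - v)) • (Tmat s u 0 1 * Tmat s v 0 0) := by
  have h0 : u - v ≠ 0 := sub_ne_zero.mpr h
  have h1 := Tmat_rtt hs v u 0 1 0 0
  refine smul_right_injective _ h0 ?_
  simp only [smul_add, smul_smul, mul_sub, mul_div_cancel₀ _ h0, mul_one]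
  linear_combination (norm := module) h1

theorem Tmat_11_mul_01 {N : ℕ} {s : List (Fin N)} (hs : s.Nodup) {u v : ℂ} (h : u ≠ v) :
    Tmat s u 1 1 * Tmat s v 0 1 = (1 - -Complex.I / (u - v)) • (Tmat s v 0 1 * Tmat s u 1 1) +
      (-Complex.I / (u - v)) • (Tmat s u 0 1 * Tmat s v 1 1) := by
  have h0 : u - v ≠ 0 := sub_ne_zero.mpr h
  have h1 := Tmat_rtt hs u v 1 1 0 1
  refine smul_right_injective _ h0 ?_
  simp only [smul_add, smul_smul, mul_sub, mul_div_cancel₀ _ h0, mul_one]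
  linear_combination (norm := module) h1

/-- The off-shell action of an operator family with rational exchange relations on the vectors
generated by the commuting family `B`. -/
theorem mulVec_offshell {n : Type*} [Fintype n] {A B : ℂ → Matrix n n ℂ}
    {W : Finset ℂ → n → ℂ} {α : ℂ → ℂ} {η : ℂ} (hB : ∀ x y, Commute (B x) (B y))
    (hA : ∀ x y, x ≠ y →
      A x * B y = (1 - η / (x - y)) • (B y * A x) + (η / (x - y)) • (B x * A y))
    (hW : ∀ a s, a ∉ s → W (insert a s) = (B a).mulVec (W s))
    (hv : ∀ x, (A x).mulVec (W ∅) = α x • W ∅) (s : Finset ℂ) (x : ℂ) (hx : x ∉ s) :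
    (A x).mulVec (W s) = (α x * ∏ j ∈ s, (1 - η / (x - j))) • W s +
      ∑ k ∈ s, (η / (x - k) * (α k * ∏ j ∈ s.erase k, (1 - η / (k - j)))) •
        (B x).mulVec (W (s.erase k)) := by
  induction s using Finset.induction_on generalizing x with
  | empty => simp [hv]
  | insert y t hy ih =>
    have hxy : x ≠ y := fun h => hx (h ▸ Finset.mem_insert_self x t)
    have hxt : x ∉ t := fun h => hx (Finset.mem_insert_of_mem h)
    rw [hW y t hy, Matrix.mulVec_mulVec, hA x y hxy, Matrix.add_mulVec, Matrix.smul_mulVec,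
      Matrix.smul_mulVec, ← Matrix.mulVec_mulVec, ← Matrix.mulVec_mulVec, ih x hxt, ih y hy,
      Finset.sum_insert hy, Finset.prod_insert hy, Finset.erase_insert hy]
    have hsum : ∑ k ∈ t, (η / (x - k) *
          (α k * ∏ j ∈ (insert y t).erase k, (1 - η / (k - j)))) •
          (B x).mulVec (W ((insert y t).erase k)) =
        ∑ k ∈ t, (η / (x - k) * ((1 - η / (k - y)) *
          (α k * ∏ j ∈ t.erase k, (1 - η / (k - j))))) •
          (B x).mulVec ((B y).mulVec (W (t.erase k))) := by
      refine Finset.sum_congr rfl fun k hk => ?_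
      have hky : y ≠ k := (ne_of_mem_of_not_mem hk hy).symm
      have hyk : y ∉ t.erase k := fun h => hy (Finset.mem_of_mem_erase h)
      rw [Finset.erase_insert_of_ne hky, Finset.prod_insert hyk, hW y _ hyk]
      congr 2
      ring
    have hcoef : ∀ k ∈ t, (1 - η / (x - y)) * (η / (x - k)) + η / (x - y) * (η / (y - k)) =
        η / (x - k) * (1 - η / (k - y)) := by
      intro k hk
      have h1 : x - y ≠ 0 := sub_ne_zero.mpr hxy
      have h2 : x - k ≠ 0 := sub_ne_zero.mpr (ne_of_mem_of_not_mem hk hxt).symm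
      have h3 : y - k ≠ 0 := sub_ne_zero.mpr (ne_of_mem_of_not_mem hk hy).symm
      have h4 : k - y ≠ 0 := sub_ne_zero.mpr (ne_of_mem_of_not_mem hk hy)
      rw [← neg_sub y k, div_neg]
      field_simp
      ring
    rw [hsum]
    simp only [Matrix.mulVec_add, Matrix.mulVec_smul, Matrix.mulVec_sum, smul_add,
      Finset.smul_sum, smul_smul]
    have hcomb : ∑ k ∈ t, ((1 - η / (x - y)) * (η / (x - k) *
          (α k * ∏ j ∈ t.erase k, (1 - η / (k - j))))) •
          (B y).mulVec ((B x).mulVec (W (t.erase k))) +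
        ∑ k ∈ t, (η / (x - y) * (η / (y - k) *
          (α k * ∏ j ∈ t.erase k, (1 - η / (k - j))))) •
          (B x).mulVec ((B y).mulVec (W (t.erase k))) =
        ∑ k ∈ t, (η / (x - k) * ((1 - η / (k - y)) *
          (α k * ∏ j ∈ t.erase k, (1 - η / (k - j))))) •
          (B x).mulVec ((B y).mulVec (W (t.erase k))) := by
      rw [← Finset.sum_add_distrib]
      refine Finset.sum_congr rfl fun k hk => ?_
      rw [Matrix.mulVec_mulVec (W (t.erase k)) (B y), (hB y x).eq, ← Matrix.mulVec_mulVec,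
        ← add_smul]
      congr 1
      linear_combination (α k * ∏ j ∈ t.erase k, (1 - η / (k - j))) * hcoef k hk
    rw [← hcomb]
    module

/-! ### The Hamiltonian and the transfer matrix -/

theorem trace_Tmat_append_comm {N : ℕ} {s t : List (Fin N)} (h : (s ++ t).Nodup) (u : ℂ) :
    (Tmat (s ++ t) u).trace = (Tmat (t ++ s) u).trace := by
  simp only [Tmat_append, Matrix.trace, Matrix.diag, Matrix.mul_apply]
  rw [Finset.sum_comm]
  refine Finset.sum_congr rfl fun a _ => Finset.sum_congr rfl fun b _ => ?_
  exact (Tmat_commute_Tmat (List.disjoint_of_nodup_append h) _ _ _ _ _ _).eq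

/-- The permutation operator of the tensor factors `k` and `k'`. -/
def permOp {N : ℕ} (k k' : Fin N) : Op N :=
  unitOp k 0 0 * unitOp k' 0 0 + unitOp k 0 1 * unitOp k' 1 0 +
    unitOp k 1 0 * unitOp k' 0 1 + unitOp k 1 1 * unitOp k' 1 1

theorem unitOp_mul_assoc {N : ℕ} (k : Fin N) (a b c d : Fin 2) (x : Op N) :
    unitOp k a b * (unitOp k c d * x) = if b = c then unitOp k a d * x else 0 := by
  rw [← mul_assoc, unitOp_mul]
  split_ifs <;> simp

theorem permOp_mul_self {N : ℕ} {k k' : Fin N} (h : k ≠ k') : permOp k k' * permOp k k' = 1 := by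
  have h2 (a b c d) (x : Op N) :
      unitOp k' c d * (unitOp k a b * x) = unitOp k a b * (unitOp k' c d * x) :=
    (unitOp_commute h.symm _ _ _ _).left_comm _
  have h3 : (unitOp k 0 0 + unitOp k 1 1) * (unitOp k' 0 0 + unitOp k' 1 1) = 1 := by
    rw [unitOp_sum, unitOp_sum, one_mul]
  rw [← h3]
  simp only [permOp, add_mul, mul_add, mul_assoc, h2, unitOp_mul, unitOp_mul_assoc]
  simp
  abel

theorem permOp_mul_Lmat {N : ℕ} {k k' : Fin N} (h : k ≠ k') (a b : Fin 2) :
    permOp k k' * (Lmat 0 k' * Lmat 0 k) a b = Complex.I • Lmat 0 k' a b := by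
  have h1 (a b c d) : unitOp k' c d * unitOp k a b = unitOp k a b * unitOp k' c d :=
    (unitOp_commute h.symm _ _ _ _).eq
  have h2 (a b c d) (x : Op N) :
      unitOp k' c d * (unitOp k a b * x) = unitOp k a b * (unitOp k' c d * x) :=
    (unitOp_commute h.symm _ _ _ _).left_comm _
  have h3 : Lmat 0 k' a b = (unitOp k 0 0 + unitOp k 1 1) * Lmat 0 k' a b := by
    rw [unitOp_sum, one_mul]
  rw [h3, Matrix.mul_apply, Fin.sum_univ_two]
  simp only [Lmat_apply, zero_smul, ite_self, zero_add, smul_mul_assoc, mul_smul_comm,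
    smul_smul, Complex.I_mul_I, ← smul_add]
  congr 1
  simp only [permOp, add_mul, mul_add, mul_assoc, h1, h2, unitOp_mul, unitOp_mul_assoc]
  fin_cases a <;> fin_cases b <;> simp

theorem permOp_mul_trace {N : ℕ} {k k' : Fin N} (h : k ≠ k') (t : List (Fin N)) :
    permOp k k' * (Tmat (k' :: k :: t) 0).trace = Complex.I • (Tmat (k' :: t) 0).trace := by
  rw [Tmat_cons, Tmat_cons, ← mul_assoc, Tmat_cons]
  simp only [Matrix.trace, Matrix.diag, Matrix.mul_apply (N := Tmat t 0), Finset.mul_sum,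
    Finset.smul_sum, ← mul_assoc, permOp_mul_Lmat h, smul_mul_assoc]

theorem isUnit_trace_Tmat {N : ℕ} (k : Fin N) (s : List (Fin N)) (hs : (k :: s).Nodup) :
    IsUnit (Tmat (k :: s) 0).trace := by
  have hI : IsUnit Complex.I := isUnit_iff_ne_zero.mpr Complex.I_ne_zero
  have hsm (x : Op N) (hx : IsUnit x) : IsUnit (Complex.I • x) := by
    rw [← one_mul x, ← smul_mul_assoc]
    refine IsUnit.mul ?_ hx
    rw [← Algebra.algebraMap_eq_smul_one]
    exact hI.map _
  induction s with
  | nil =>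
    have h : (Tmat [k] 0).trace = Complex.I • (1 : Op N) := by
      simp [Tmat, Matrix.trace, Matrix.diag, Lmat_apply, ← smul_add, unitOp_sum]
    rw [h]
    exact hsm 1 isUnit_one
  | cons j t ih =>
    have hjk : j ≠ k := by
      rintro rfl
      simp at hs
    have h := congrArg (permOp j k * ·) (permOp_mul_trace hjk t)
    simp only [← mul_assoc, permOp_mul_self hjk, one_mul] at h
    rw [h]
    refine IsUnit.mul (.of_mul_eq_one _ (permOp_mul_self hjk)) (hsm _ (ih ?_))
    exact hs.sublist (by simp)

theorem Lmat_eq_add {N : ℕ} (u : ℂ) (k : Fin N) : Lmat u k = u • 1 + Lmat 0 k := by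
  refine Matrix.ext fun a b => ?_
  rw [Matrix.add_apply, Matrix.smul_apply, Lmat_apply, Lmat_apply, Matrix.one_apply]
  split_ifs <;> simp

theorem continuous_Tmat {N : ℕ} (s : List (Fin N)) : Continuous (Tmat s) := by
  induction s with
  | nil => exact continuous_const
  | cons k s ih =>
    have h : Tmat (k :: s) = fun u => (u • 1 + Lmat 0 k) * Tmat s u := by
      ext1 u
      rw [Tmat_cons, ← Lmat_eq_add]
    rw [h]
    fun_prop

theorem tendsto_Tmat_slope {N : ℕ} {s : List (Fin N)} (hs : s.Nodup) :
    Tendsto (fun u : ℂ => u⁻¹ • (Tmat s u - Tmat s 0)) (𝓝[≠] 0)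
      (𝓝 (∑ k ∈ s.toFinset, Tmat (s.erase k) 0)) := by
  induction s with
  | nil => simp [Tmat]
  | cons k s ih =>
    rw [List.nodup_cons] at hs
    have hk : k ∉ s.toFinset := by simpa using hs.1
    rw [List.toFinset_cons, Finset.sum_insert hk, List.erase_cons_head]
    have h1 : ∑ j ∈ s.toFinset, Tmat ((k :: s).erase j) 0 =
        Lmat 0 k * ∑ j ∈ s.toFinset, Tmat (s.erase j) 0 := by
      rw [Finset.mul_sum]
      refine Finset.sum_congr rfl fun j hj => ?_
      rw [List.erase_cons_tail, Tmat_cons]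
      simpa using (ne_of_mem_of_not_mem hj hk).symm
    rw [h1]
    have h2 : Tendsto (Tmat s) (𝓝[≠] 0) (𝓝 (Tmat s 0)) :=
      ((continuous_Tmat s).tendsto 0).mono_left nhdsWithin_le_nhds
    refine (h2.add ((ih hs.2).const_mul (Lmat 0 k))).congr' ?_
    filter_upwards [self_mem_nhdsWithin] with u hu
    have hu : u ≠ 0 := hu
    rw [Tmat_cons, Tmat_cons, Lmat_eq_add u k, add_mul, smul_mul_assoc, one_mul, mul_smul_comm,
      mul_sub, add_sub_assoc, smul_add, smul_smul, inv_mul_cancel₀ hu, one_smul]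

theorem exists_rotation {N : ℕ} (hN : 2 ≤ N) (k : Fin N) : ∃ s t X : List (Fin N),
    (List.finRange N).reverse = s ++ t ∧ t ++ s = cyc k :: k :: X ∧
      ∃ s' t', (List.finRange N).reverse.erase k = s' ++ t' ∧ t' ++ s' = cyc k :: X := by
  have hnd : (List.finRange N).reverse.Nodup := List.nodup_reverse.mpr (List.nodup_finRange N)
  by_cases hk : k.1 + 1 < N
  · have hc : cyc k = ⟨k.1 + 1, hk⟩ := by
      ext
      simp [cyc, Nat.mod_eq_of_lt hk]
    have h1 : List.finRange N = (List.finRange N).take k.1 ++ k :: cyc k ::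
        (List.finRange N).drop (k.1 + 2) := by
      conv_lhs => rw [← List.take_append_drop k.1 (List.finRange N)]
      rw [List.drop_eq_getElem_cons (by simp), List.drop_eq_getElem_cons (by simpa using hk), hc]
      simp
    have h2 : (List.finRange N).reverse = ((List.finRange N).drop (k.1 + 2)).reverse ++
        (cyc k :: k :: ((List.finRange N).take k.1).reverse) := by
      conv_lhs => rw [h1]
      simp
    refine ⟨_, _, ((List.finRange N).take k.1).reverse ++
      ((List.finRange N).drop (k.1 + 2)).reverse, h2, by simp,
      ((List.finRange N).drop (k.1 + 2)).reverse,
      cyc k :: ((List.finRange N).take k.1).reverse, ?_, by simp⟩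
    rw [h2] at hnd ⊢
    have h3 : k ∉ ((List.finRange N).drop (k.1 + 2)).reverse := fun h =>
      List.disjoint_of_nodup_append hnd h (by simp)
    have h4 : cyc k ≠ k := fun h => by simpa [hc] using congrArg Fin.val h
    rw [List.erase_append_right _ h3, List.erase_cons_tail (by simpa using h4),
      List.erase_cons_head]
  · have hc : cyc k = ⟨0, by omega⟩ := by
      ext
      have : k.1 + 1 = N := by omega
      simp [cyc, this]
    have h1 : List.finRange N = cyc k :: (((List.finRange N).drop 1).take (N - 2) ++ [k]) := by
      refine List.ext_getElem (by simp; omega) fun i hi hi' => ?_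
      rw [hc]
      rcases i with _ | i
      · simp
      · simp only [List.getElem_cons_succ, List.getElem_append, List.getElem_finRange]
        simp at hi
        split_ifs with h
        · simp
        · ext
          simp at h ⊢
          omega
    set m := ((List.finRange N).drop 1).take (N - 2)
    have h2 : (List.finRange N).reverse = (k :: m.reverse) ++ [cyc k] := by
      conv_lhs => rw [h1]
      simp
    refine ⟨_, _, m.reverse, h2, by simp, m.reverse, [cyc k], ?_, by simp⟩
    rw [h2, List.cons_append, List.erase_cons_head]

theorem cyc_ne {N : ℕ} (hN : 2 ≤ N) (k : Fin N) : k ≠ cyc k := by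
  intro h
  have h1 : k.1 = (k.1 + 1) % N := congrArg Fin.val h
  rcases Nat.lt_or_ge (k.1 + 1) N with h2 | h2
  · rw [Nat.mod_eq_of_lt h2] at h1
    omega
  · have h3 : k.1 + 1 = N := by omega
    rw [h3, Nat.mod_self] at h1
    omega

theorem permOp_mul_trace_Tmat {N : ℕ} (hN : 2 ≤ N) (k : Fin N) :
    permOp k (cyc k) * (Tmat (List.finRange N).reverse 0).trace =
      Complex.I • (Tmat ((List.finRange N).reverse.erase k) 0).trace := by
  have hnd : (List.finRange N).reverse.Nodup := List.nodup_reverse.mpr (List.nodup_finRange N)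
  obtain ⟨s, t, X, hst, hts, s', t', hst', hts'⟩ := exists_rotation hN k
  have hnd' := hnd.erase k
  rw [hst'] at hnd' ⊢
  rw [hst] at hnd ⊢
  rw [trace_Tmat_append_comm hnd, hts, permOp_mul_trace (cyc_ne hN k),
    trace_Tmat_append_comm hnd', hts']

theorem siteOp_sum_eq_permOp {N : ℕ} (k k' : Fin N) :
    ∑ a : Fin 3, siteOp N a k * siteOp N a k' = (2 : ℂ) • permOp k k' - 1 := by
  have h1 : (1 : Op N) = (unitOp k 0 0 + unitOp k 1 1) * (unitOp k' 0 0 + unitOp k' 1 1) := by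
    rw [unitOp_sum, unitOp_sum, one_mul]
  rw [h1]
  simp only [siteOp_eq_siteHom, siteHom_eq_unitOp, Fin.sum_univ_three, permOp]
  simp [pauli, mul_add, add_mul, smul_smul]
  module

theorem Ham_mul_trace {N : ℕ} (hN : 2 ≤ N) (J : ℝ) :
    Ham N J * (Tmat (List.finRange N).reverse 0).trace =
      ((J : ℂ) / 4) • ((2 * Complex.I) •
        (∑ k ∈ (List.finRange N).reverse.toFinset,
          Tmat ((List.finRange N).reverse.erase k) 0).trace -
        (2 * N : ℂ) • (Tmat (List.finRange N).reverse 0).trace) := by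
  have h1 : (List.finRange N).reverse.toFinset = Finset.univ := by
    ext
    simp
  rw [Ham, smul_mul_assoc, Finset.sum_mul, h1, Matrix.trace_sum]
  congr 1
  simp only [siteOp_sum_eq_permOp, sub_mul, smul_mul_assoc, permOp_mul_trace_Tmat hN, one_mul,
    Finset.sum_sub_distrib, Finset.sum_const, Finset.card_univ, Fintype.card_fin,
    ← Finset.smul_sum, smul_smul]
  rw [← Nat.cast_smul_eq_nsmul ℂ]
  module

/-- A common eigenvector of the transfer matrices near `λ = i/2` is an eigenvector of the
Hamiltonian. -/
theorem Ham_eigenvector_of_trace_Tmat {N : ℕ} (hN : 2 ≤ N) (J : ℝ) (Ψ : St N → ℂ)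
    (h : ∀ᶠ u in 𝓝[≠] (0 : ℂ), ∃ E : ℂ,
      (Tmat (List.finRange N).reverse u).trace.mulVec Ψ = E • Ψ) :
    ∃ E : ℂ, (Ham N J).mulVec Ψ = E • Ψ := by
  set l := (List.finRange N).reverse with hl
  have hnd : l.Nodup := List.nodup_reverse.mpr (List.nodup_finRange N)
  by_cases hΨ : Ψ = 0
  · exact ⟨0, by simp [hΨ]⟩
  set S : Submodule ℂ (St N → ℂ) := Submodule.span ℂ {Ψ} with hS
  have hcl : IsClosed (S : Set (St N → ℂ)) := S.closed_of_finiteDimensional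
  have hmem : ∀ᶠ u in 𝓝[≠] (0 : ℂ), (Tmat l u).trace.mulVec Ψ ∈ S := by
    filter_upwards [h] with u ⟨E, hE⟩
    rw [hE]
    exact S.smul_mem _ (Submodule.mem_span_singleton_self Ψ)
  have hc : Continuous fun M : Matrix (Fin 2) (Fin 2) (Op N) => M.trace.mulVec Ψ := by fun_prop
  have h0 : (Tmat l 0).trace.mulVec Ψ ∈ S :=
    hcl.mem_of_tendsto (((hc.comp (continuous_Tmat l)).tendsto 0).mono_left nhdsWithin_le_nhds) hmem
  have h1 : (∑ k ∈ l.toFinset, Tmat (l.erase k) 0).trace.mulVec Ψ ∈ S := by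
    refine hcl.mem_of_tendsto ((hc.tendsto _).comp (tendsto_Tmat_slope hnd)) ?_
    filter_upwards [hmem] with u hu
    simp only [Function.comp, Matrix.trace_smul, Matrix.trace_sub, Matrix.smul_mulVec,
      Matrix.sub_mulVec]
    exact S.smul_mem _ (S.sub_mem hu h0)
  obtain ⟨e, he⟩ := Submodule.mem_span_singleton.mp h0
  have hunit : IsUnit (Tmat l 0).trace := by
    cases hl' : l with
    | nil =>
      have := congrArg List.length hl'
      simp [hl] at this
      omega
    | cons k s => exact isUnit_trace_Tmat k s (hl' ▸ hnd)
  have he0 : e ≠ 0 := by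
    rintro rfl
    refine hΨ (Matrix.mulVec_injective_of_isUnit hunit ?_)
    rw [← he, zero_smul, Matrix.mulVec_zero]
  have h2 : (Ham N J).mulVec ((Tmat l 0).trace.mulVec Ψ) ∈ S := by
    rw [Matrix.mulVec_mulVec, Ham_mul_trace hN, ← hl, Matrix.smul_mulVec, Matrix.sub_mulVec,
      Matrix.smul_mulVec, Matrix.smul_mulVec]
    exact S.smul_mem _ (S.sub_mem (S.smul_mem _ h1) (S.smul_mem _ h0))
  rw [← he, Matrix.mulVec_smul] at h2
  obtain ⟨E, hE⟩ := Submodule.mem_span_singleton.mp ((S.smul_mem_iff he0).mp h2)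
  exact ⟨E, hE.symm⟩

/-! ### The regularized Bethe vector -/

/-- The eigenvalue of the transfer matrix, in terms of shifted rapidities. -/
def wanted (n : ℕ) (u : ℂ) (S : Finset ℂ) : ℂ :=
  (u + Complex.I) ^ n * ∏ j ∈ S, (1 - Complex.I / (u - j)) +
    u ^ n * ∏ j ∈ S, (1 - -Complex.I / (u - j))

/-- The coefficient of the unwanted term that exchanges the rapidity `k` for `u`, the remaining
rapidities being the elements of `S`. -/
def unwanted (n : ℕ) (u k : ℂ) (S : Finset ℂ) : ℂ :=
  Complex.I / (u - k) * ((k + Complex.I) ^ n * ∏ j ∈ S, (1 - Complex.I / (k - j)) -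
    k ^ n * ∏ j ∈ S, (1 - -Complex.I / (k - j)))

/-- The Bethe vector with the set `S` of (shifted) rapidities. -/
def offshellVec {N : ℕ} {s : List (Fin N)} (hs : s.Nodup) (S : Finset ℂ) : St N → ℂ :=
  (S.noncommProd (fun u => Tmat s u 0 1) fun _ _ _ _ _ => Tmat_01_commute hs _ _).mulVec (vac N)

theorem offshellVec_insert {N : ℕ} {s : List (Fin N)} (hs : s.Nodup) (u : ℂ) (S : Finset ℂ)
    (hu : u ∉ S) :
    offshellVec hs (insert u S) = (Tmat s u 0 1).mulVec (offshellVec hs S) := by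
  have h := Finset.noncommProd_insert_of_notMem S u (fun u => Tmat s u 0 1)
    (fun x _ y _ _ => Tmat_01_commute hs x y) hu
  exact (congrArg (Matrix.mulVec · (vac N)) h).trans (Matrix.mulVec_mulVec _ _ _).symm

theorem trace_mulVec_offshellVec {N : ℕ} {s : List (Fin N)} (hs : s.Nodup) (S : Finset ℂ) (u : ℂ)
    (hu : u ∉ S) :
    (Tmat s u).trace.mulVec (offshellVec hs S) = wanted s.length u S • offshellVec hs S +
      ∑ k ∈ S, unwanted s.length u k (S.erase k) •
        (Tmat s u 0 1).mulVec (offshellVec hs (S.erase k)) := by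
  have h0 : offshellVec hs ∅ = vac N :=
    (congrArg (Matrix.mulVec · (vac N)) (Finset.noncommProd_empty _ _)).trans
      (Matrix.one_mulVec _)
  have hA := mulVec_offshell (A := fun u => Tmat s u 0 0) (B := fun u => Tmat s u 0 1)
    (Tmat_01_commute hs) (fun x y h => Tmat_00_mul_01 hs h) (offshellVec_insert hs)
    (fun x => h0 ▸ (Tmat_mulVec_vac hs x).2.1) S u hu
  have hD := mulVec_offshell (A := fun u => Tmat s u 1 1) (B := fun u => Tmat s u 0 1)
    (Tmat_01_commute hs) (fun x y h => Tmat_11_mul_01 hs h) (offshellVec_insert hs)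
    (fun x => h0 ▸ (Tmat_mulVec_vac hs x).2.2) S u hu
  have ht : (Tmat s u).trace = Tmat s u 0 0 + Tmat s u 1 1 := by
    simp [Matrix.trace, Matrix.diag]
  rw [ht, Matrix.add_mulVec, hA, hD, add_add_add_comm, ← add_smul, ← Finset.sum_add_distrib]
  congr 1
  refine Finset.sum_congr rfl fun k _ => ?_
  rw [← add_smul]
  congr 1
  rw [unwanted]
  ring

theorem Tmat_add {N : ℕ} (s : List (Fin N)) :
    ∃ Q : ℂ → ℂ → Matrix (Fin 2) (Fin 2) (Op N), Continuous (fun p : ℂ × ℂ => Q p.1 p.2) ∧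
      ∀ x y, Tmat s (x + y) = Tmat s x + y • Q x y := by
  induction s with
  | nil => exact ⟨0, continuous_const, fun x y => by simp [Tmat]⟩
  | cons k s ih =>
    obtain ⟨Q, hQ, h⟩ := ih
    refine ⟨fun x y => Lmat x k * Q x y + Tmat s (x + y), ?_, fun x y => ?_⟩
    · have h1 := continuous_Tmat s
      have h2 : (fun p : ℂ × ℂ => Lmat p.1 k) = fun p => p.1 • 1 + Lmat 0 k :=
        funext fun p => Lmat_eq_add _ _
      have h3 : Continuous fun p : ℂ × ℂ => Lmat p.1 k := by
        rw [h2]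
        fun_prop
      exact (h3.mul hQ).add (h1.comp continuous_add)
    · have h1 : Lmat (x + y) k = Lmat x k + y • 1 := by
        rw [Lmat_eq_add, Lmat_eq_add x]
        module
      rw [Tmat_cons, Tmat_cons, h1, add_mul, smul_mul_assoc, one_mul]
      conv_lhs => rw [h x y, mul_add, mul_smul_comm, ← h x y]
      module

theorem Tmat_mul_Tmat_regularized {N : ℕ} {s : List (Fin N)} (hs : s.Nodup) (c : ℂ) :
    ∃ F : ℂ → Op N, Continuous F ∧ ∀ e,
      Tmat s (e + c * e ^ s.length) 0 1 * Tmat s (e - Complex.I) 0 1 = e ^ s.length • F e := by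
  obtain ⟨Q, hQ, hQe⟩ := Tmat_mul_Tmat_fusion hs
  obtain ⟨D, hD, hDe⟩ := Tmat_add s
  refine ⟨fun e => Q e + c • (D e (c * e ^ s.length) 0 1 * Tmat s (e - Complex.I) 0 1), ?_,
    fun e => ?_⟩
  · have h1 : Continuous fun e => Tmat s (e - Complex.I) 0 1 :=
      ((continuous_Tmat s).comp (continuous_sub_right Complex.I)).matrix_elem 0 1
    have h2 : Continuous fun e : ℂ => D e (c * e ^ s.length) 0 1 :=
      (hD.comp (by fun_prop : Continuous fun e : ℂ => (e, c * e ^ s.length))).matrix_elem 0 1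
    exact hQ.add ((h2.mul h1).const_smul c)
  · rw [hDe, Matrix.add_apply, Matrix.smul_apply, add_mul, hQe, smul_mul_assoc, smul_add, smul_smul,
      mul_comm c]

theorem continuousAt_prod_one_sub {M : Finset ℂ} {x : ℂ → ℂ} (hx : Continuous x) (η a : ℂ)
    (h : x a ∉ M) : ContinuousAt (fun e => ∏ j ∈ M, (1 - η / (x e - j))) a := by
  refine tendsto_finsetProd M fun j hj => ?_
  refine ContinuousAt.sub continuousAt_const (continuousAt_const.div (by fun_prop) ?_)
  exact sub_ne_zero.mpr (ne_of_mem_of_not_mem hj h).symm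

theorem eventually_notMem {M : Finset ℂ} {x : ℂ → ℂ} {a : ℂ} (hx : ContinuousAt x a)
    (h : x a ∉ M) : ∀ᶠ e in 𝓝 a, x e ∉ M :=
  hx.eventually (M.finite_toSet.isClosed.isOpen_compl.mem_nhds h)

section Regularization

variable (N : ℕ) (c u : ℂ) (M : Finset ℂ)

theorem eventually_regular (hN : N ≠ 0) (h0 : (0 : ℂ) ∉ M) (hM : -Complex.I ∉ M) :
    ∀ᶠ e in 𝓝[≠] (0 : ℂ), e ≠ 0 ∧ e + c * e ^ N ≠ e - Complex.I ∧ e + c * e ^ N ∉ M ∧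
      e - Complex.I ∉ M := by
  have e1 : ∀ᶠ e in 𝓝 (0 : ℂ), Complex.I + c * e ^ N ≠ 0 :=
    ContinuousAt.eventually_ne (by fun_prop) (by simp [hN])
  have e2 : ∀ᶠ e in 𝓝 (0 : ℂ), e + c * e ^ N ∉ M :=
    eventually_notMem (by fun_prop) (by simpa [hN] using h0)
  have e3 : ∀ᶠ e in 𝓝 (0 : ℂ), e - Complex.I ∉ M :=
    eventually_notMem (by fun_prop) (by simpa using hM)
  filter_upwards [self_mem_nhdsWithin, e1.filter_mono nhdsWithin_le_nhds,
    e2.filter_mono nhdsWithin_le_nhds, e3.filter_mono nhdsWithin_le_nhds] with e he h1 h2 h3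
  exact ⟨he, fun h => h1 (by linear_combination h), h2, h3⟩

theorem tendsto_unwanted_first (hN : 2 ≤ N) (hu : u ≠ 0) (h0 : (0 : ℂ) ∉ M)
    (hM : -Complex.I ∉ M)
    (hc : Complex.I ^ N * (c / Complex.I) * ∏ j ∈ M, (1 - Complex.I / (0 - j)) =
      2 * ∏ j ∈ M, (1 - -Complex.I / (0 - j))) :
    Tendsto (fun e : ℂ => (e ^ N)⁻¹ * unwanted N u (e + c * e ^ N) (insert (e - Complex.I) M))
      (𝓝[≠] 0) (𝓝 0) := by
  have hN0 : N ≠ 0 := by omega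
  have hN1 : N - 1 ≠ 0 := by omega
  have hI := Complex.I_ne_zero
  set g : ℂ → ℂ := fun e => Complex.I / (u - (e + c * e ^ N)) *
    ((e + c * e ^ N + Complex.I) ^ N * (c / (Complex.I + c * e ^ N)) *
      ∏ j ∈ M, (1 - Complex.I / (e + c * e ^ N - j)) -
    (1 + c * e ^ (N - 1)) ^ N * (1 - -Complex.I / (Complex.I + c * e ^ N)) *
      ∏ j ∈ M, (1 - -Complex.I / (e + c * e ^ N - j))) with hg
  have hx : Continuous fun e : ℂ => e + c * e ^ N := by fun_prop
  have hgc : ContinuousAt g 0 := by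
    have p1 := continuousAt_prod_one_sub hx Complex.I 0 (M := M) (by simpa [hN0] using h0)
    have p2 := continuousAt_prod_one_sub hx (-Complex.I) 0 (M := M) (by simpa [hN0] using h0)
    have d1 : u - ((0 : ℂ) + c * 0 ^ N) ≠ 0 := by simpa [hN0] using hu
    have d2 : Complex.I + c * (0 : ℂ) ^ N ≠ 0 := by simp [hN0]
    fun_prop (disch := assumption)
  have hg0 : g 0 = 0 := by
    simp only [hg, zero_pow hN0, zero_pow hN1, mul_zero, add_zero, zero_add, one_pow, one_mul]
    rw [hc, neg_div, div_self hI]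
    ring
  have hlim := hgc.tendsto.mono_left (nhdsWithin_le_nhds (s := {0}ᶜ))
  rw [hg0] at hlim
  refine hlim.congr' ?_
  filter_upwards [eventually_regular N c M hN0 h0 hM] with e ⟨he, h12, _, h2⟩
  have h1 : Complex.I + c * e ^ N ≠ 0 := fun h => h12 (by linear_combination h)
  have h3 : e + c * e ^ N - (e - Complex.I) = Complex.I + c * e ^ N := by ring
  have h4 : 1 - Complex.I / (Complex.I + c * e ^ N) = e ^ N * (c / (Complex.I + c * e ^ N)) := by
    field_simp
    ring
  have h5 : (e + c * e ^ N) ^ N = e ^ N * (1 + c * e ^ (N - 1)) ^ N := by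
    rw [← mul_pow]
    congr 1
    obtain ⟨n, rfl⟩ : ∃ n, N = n + 1 := ⟨N - 1, by omega⟩
    simp
    ring
  rw [unwanted, Finset.prod_insert h2, Finset.prod_insert h2, h3, h4, h5]
  simp only [hg]
  field_simp

theorem tendsto_unwanted_second (hN : 2 ≤ N) (hu : u ≠ -Complex.I) (h0 : (0 : ℂ) ∉ M)
    (hM : -Complex.I ∉ M)
    (hc : 2 * ∏ j ∈ M, (1 - Complex.I / (-Complex.I - j)) =
      (-Complex.I) ^ N * (c / Complex.I) * ∏ j ∈ M, (1 - -Complex.I / (-Complex.I - j))) :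
    Tendsto (fun e : ℂ => (e ^ N)⁻¹ * unwanted N u (e - Complex.I) (insert (e + c * e ^ N) M))
      (𝓝[≠] 0) (𝓝 0) := by
  have hN0 : N ≠ 0 := by omega
  have hI := Complex.I_ne_zero
  set g : ℂ → ℂ := fun e => Complex.I / (u - (e - Complex.I)) *
    ((1 - -Complex.I / (Complex.I + c * e ^ N)) * ∏ j ∈ M, (1 - Complex.I / (e - Complex.I - j)) -
    (e - Complex.I) ^ N * (c / (Complex.I + c * e ^ N)) *
      ∏ j ∈ M, (1 - -Complex.I / (e - Complex.I - j))) with hg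
  have hx : Continuous fun e : ℂ => e - Complex.I := by fun_prop
  have hgc : ContinuousAt g 0 := by
    have p1 := continuousAt_prod_one_sub hx Complex.I 0 (M := M) (by simpa using hM)
    have p2 := continuousAt_prod_one_sub hx (-Complex.I) 0 (M := M) (by simpa using hM)
    have d1 : u - ((0 : ℂ) - Complex.I) ≠ 0 := by
      rw [zero_sub]
      exact sub_ne_zero.mpr hu
    have d2 : Complex.I + c * (0 : ℂ) ^ N ≠ 0 := by simp [hN0]
    fun_prop (disch := assumption)
  have hg0 : g 0 = 0 := by
    simp only [hg, zero_pow hN0, mul_zero, add_zero, zero_sub]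
    rw [← hc, neg_div, div_self hI]
    ring
  have hlim := hgc.tendsto.mono_left (nhdsWithin_le_nhds (s := {0}ᶜ))
  rw [hg0] at hlim
  refine hlim.congr' ?_
  filter_upwards [eventually_regular N c M hN0 h0 hM] with e ⟨he, h12, h2, _⟩
  have h1 : Complex.I + c * e ^ N ≠ 0 := fun h => h12 (by linear_combination h)
  have h3 : e - Complex.I - (e + c * e ^ N) = -(Complex.I + c * e ^ N) := by ring
  have h4 : 1 - -Complex.I / -(Complex.I + c * e ^ N) =
      e ^ N * (c / (Complex.I + c * e ^ N)) := by
    rw [neg_div_neg_eq]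
    field_simp
    ring
  have h5 : 1 - Complex.I / -(Complex.I + c * e ^ N) =
      1 - -Complex.I / (Complex.I + c * e ^ N) := by
    rw [div_neg, neg_div]
  rw [unwanted, Finset.prod_insert h2, Finset.prod_insert h2, h3, h4, h5, sub_add_cancel]
  simp only [hg]
  field_simp

theorem tendsto_unwanted_of_mem (hN : N ≠ 0) {k : ℂ} (hk : k ∈ M) (h0 : (0 : ℂ) ∉ M)
    (hM : -Complex.I ∉ M)
    (hc : (k + Complex.I) ^ N * ((1 - Complex.I / k) * ((1 - Complex.I / (k + Complex.I)) *
        ∏ j ∈ M.erase k, (1 - Complex.I / (k - j)))) =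
      k ^ N * ((1 - -Complex.I / k) * ((1 - -Complex.I / (k + Complex.I)) *
        ∏ j ∈ M.erase k, (1 - -Complex.I / (k - j))))) :
    Tendsto (fun e : ℂ =>
      unwanted N u k (insert (e + c * e ^ N) (insert (e - Complex.I) (M.erase k))))
      (𝓝[≠] 0) (𝓝 0) := by
  set g : ℂ → ℂ := fun e => Complex.I / (u - k) *
    ((k + Complex.I) ^ N * ((1 - Complex.I / (k - (e + c * e ^ N))) *
      ((1 - Complex.I / (k - (e - Complex.I))) * ∏ j ∈ M.erase k, (1 - Complex.I / (k - j)))) -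
    k ^ N * ((1 - -Complex.I / (k - (e + c * e ^ N))) *
      ((1 - -Complex.I / (k - (e - Complex.I))) *
        ∏ j ∈ M.erase k, (1 - -Complex.I / (k - j))))) with hg
  have hgc : ContinuousAt g 0 := by
    have d1 : k - ((0 : ℂ) + c * 0 ^ N) ≠ 0 := by
      simpa [hN] using ne_of_mem_of_not_mem hk h0
    have d2 : k - ((0 : ℂ) - Complex.I) ≠ 0 := by
      rw [zero_sub]
      exact sub_ne_zero.mpr (ne_of_mem_of_not_mem hk hM)
    fun_prop (disch := assumption)
  have hg0 : g 0 = 0 := by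
    simp only [hg, zero_pow hN, mul_zero, add_zero, zero_sub, sub_zero, sub_neg_eq_add]
    rw [hc, sub_self, mul_zero]
  have hlim := hgc.tendsto.mono_left (nhdsWithin_le_nhds (s := {0}ᶜ))
  rw [hg0] at hlim
  refine hlim.congr' ?_
  filter_upwards [eventually_regular N c M hN h0 hM] with e ⟨_, h12, h1, h2⟩
  have h1' := fun h => h1 (Finset.mem_of_mem_erase (a := k) h)
  have h2' := fun h => h2 (Finset.mem_of_mem_erase (a := k) h)
  have h3 : e + c * e ^ N ∉ insert (e - Complex.I) (M.erase k) := by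
    simpa only [Finset.mem_insert, not_or] using ⟨h12, h1'⟩
  rw [unwanted, Finset.prod_insert h3, Finset.prod_insert h3, Finset.prod_insert h2',
    Finset.prod_insert h2']

end Regularization
theorem tendsto_wanted (N : ℕ) (c u : ℂ) (M : Finset ℂ) (hN : N ≠ 0) (h0 : (0 : ℂ) ∉ M)
    (hM : -Complex.I ∉ M) (hu : u ≠ 0) (hu' : u ≠ -Complex.I) :
    ∃ E, Tendsto (fun e : ℂ => wanted N u (insert (e + c * e ^ N) (insert (e - Complex.I) M)))
      (𝓝[≠] 0) (𝓝 E) := by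
  set g : ℂ → ℂ := fun e =>
    (u + Complex.I) ^ N * ((1 - Complex.I / (u - (e + c * e ^ N))) *
      ((1 - Complex.I / (u - (e - Complex.I))) * ∏ j ∈ M, (1 - Complex.I / (u - j)))) +
    u ^ N * ((1 - -Complex.I / (u - (e + c * e ^ N))) *
      ((1 - -Complex.I / (u - (e - Complex.I))) * ∏ j ∈ M, (1 - -Complex.I / (u - j)))) with hg
  have hgc : ContinuousAt g 0 := by
    have d1 : u - ((0 : ℂ) + c * 0 ^ N) ≠ 0 := by simpa [hN] using hu
    have d2 : u - ((0 : ℂ) - Complex.I) ≠ 0 := by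
      rw [zero_sub]
      exact sub_ne_zero.mpr hu'
    fun_prop (disch := assumption)
  refine ⟨g 0, (hgc.tendsto.mono_left nhdsWithin_le_nhds).congr' ?_⟩
  filter_upwards [eventually_regular N c M hN h0 hM] with e ⟨_, h12, h1, h2⟩
  have h3 : e + c * e ^ N ∉ insert (e - Complex.I) M := by
    simpa only [Finset.mem_insert, not_or] using ⟨h12, h1⟩
  rw [wanted, Finset.prod_insert h3, Finset.prod_insert h3, Finset.prod_insert h2,
    Finset.prod_insert h2]

theorem exists_tendsto_regularized {N : ℕ} {s : List (Fin N)} (hs : s.Nodup) (c : ℂ) :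
    ∃ F : Op N, ∀ v : St N → ℂ, Tendsto (fun e : ℂ => (e ^ s.length)⁻¹ •
        (Tmat s (e + c * e ^ s.length) 0 1 * Tmat s (e - Complex.I) 0 1).mulVec v)
      (𝓝[≠] 0) (𝓝 (F.mulVec v)) := by
  obtain ⟨F, hF, h⟩ := Tmat_mul_Tmat_regularized hs c
  refine ⟨F 0, fun v => ?_⟩
  have h1 : Continuous fun e => (F e).mulVec v := hF.matrix_mulVec continuous_const
  refine (h1.continuousAt.tendsto.mono_left nhdsWithin_le_nhds).congr' ?_
  filter_upwards [self_mem_nhdsWithin] with e he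
  rw [h, Matrix.smul_mulVec, inv_smul_smul₀ (pow_ne_zero _ he)]

theorem tendsto_regularized_offshellVec {N : ℕ} {s : List (Fin N)} (hs : s.Nodup) (c : ℂ)
    (M : Finset ℂ) (hl : 2 ≤ s.length) (h0 : (0 : ℂ) ∉ M)
    (hM : -Complex.I ∉ M)
    (hc1 : Complex.I ^ s.length * (c / Complex.I) * ∏ j ∈ M, (1 - Complex.I / (0 - j)) =
      2 * ∏ j ∈ M, (1 - -Complex.I / (0 - j)))
    (hc2 : 2 * ∏ j ∈ M, (1 - Complex.I / (-Complex.I - j)) =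
      (-Complex.I) ^ s.length * (c / Complex.I) *
        ∏ j ∈ M, (1 - -Complex.I / (-Complex.I - j)))
    (hk : ∀ k ∈ M, (k + Complex.I) ^ s.length * ((1 - Complex.I / k) *
        ((1 - Complex.I / (k + Complex.I)) * ∏ j ∈ M.erase k, (1 - Complex.I / (k - j)))) =
      k ^ s.length * ((1 - -Complex.I / k) * ((1 - -Complex.I / (k + Complex.I)) *
        ∏ j ∈ M.erase k, (1 - -Complex.I / (k - j))))) :
    ∃ Ψ, Tendsto (fun e : ℂ => (e ^ s.length)⁻¹ •
        (Tmat s (e + c * e ^ s.length) 0 1 * Tmat s (e - Complex.I) 0 1).mulVec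
          (offshellVec hs M)) (𝓝[≠] 0) (𝓝 Ψ) ∧
      ∀ᶠ u in 𝓝[≠] 0, ∃ E : ℂ, (Tmat s u).trace.mulVec Ψ = E • Ψ := by
  obtain ⟨F, hF⟩ := exists_tendsto_regularized hs c
  refine ⟨_, hF _, ?_⟩
  have hn : s.length ≠ 0 := by omega
  have hI : (0 : ℂ) ≠ -Complex.I := (neg_ne_zero.mpr Complex.I_ne_zero).symm
  filter_upwards [self_mem_nhdsWithin, nhdsWithin_le_nhds (eventually_ne_nhds hI),
    nhdsWithin_le_nhds (eventually_notMem continuousAt_id h0)] with u hu hu' huM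
  obtain ⟨E, hE⟩ := tendsto_wanted s.length c u M hn h0 hM hu hu'
  refine ⟨E, ?_⟩
  set x₁ : ℂ → ℂ := fun e => e + c * e ^ s.length with hx₁
  set x₂ : ℂ → ℂ := fun e => e - Complex.I with hx₂
  set V : Finset ℂ → ℂ → St N → ℂ := fun S e =>
    (e ^ s.length)⁻¹ • (Tmat s (x₁ e) 0 1 * Tmat s (x₂ e) 0 1).mulVec (offshellVec hs S) with hV
  have hu1 : ∀ᶠ e in 𝓝[≠] (0 : ℂ), x₁ e ≠ u :=
    (ContinuousAt.eventually_ne (by fun_prop) (by simpa [hx₁, hn] using Ne.symm hu)).filter_mono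
      nhdsWithin_le_nhds
  have hu2 : ∀ᶠ e in 𝓝[≠] (0 : ℂ), x₂ e ≠ u :=
    (ContinuousAt.eventually_ne (by fun_prop) (by simpa [hx₂] using hu'.symm)).filter_mono
      nhdsWithin_le_nhds
  have hB : ∀ x : ℂ → ℂ, Continuous x → ∃ w, Tendsto (fun e => (Tmat s u 0 1).mulVec
      ((Tmat s (x e) 0 1).mulVec (offshellVec hs M))) (𝓝[≠] 0) (𝓝 w) := fun x hx => by
    have h1 : Continuous fun e => Tmat s (x e) 0 1 :=
      ((continuous_Tmat s).comp hx).matrix_elem 0 1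
    have h2 := continuous_const (y := Tmat s u 0 1).matrix_mulVec
      (h1.matrix_mulVec (continuous_const (y := offshellVec hs M)))
    exact ⟨_, h2.continuousAt.tendsto.mono_left nhdsWithin_le_nhds⟩
  obtain ⟨w₁, hw₁⟩ := hB x₁ (by fun_prop)
  obtain ⟨w₂, hw₂⟩ := hB x₂ (by fun_prop)
  have hmul : ∀ A : Op N, Continuous fun v : St N → ℂ => A.mulVec v := fun A =>
    continuous_const.matrix_mulVec continuous_id
  have hL : Tendsto (fun e => (Tmat s u).trace.mulVec (V M e)) (𝓝[≠] 0)
      (𝓝 ((Tmat s u).trace.mulVec (F.mulVec (offshellVec hs M)))) :=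
    ((hmul _).tendsto _).comp (hF _)
  have hR := (((hE.smul (hF (offshellVec hs M))).add
    ((tendsto_unwanted_first _ c u M hl hu h0 hM hc1).smul hw₂)).add
    ((tendsto_unwanted_second _ c u M hl hu' h0 hM hc2).smul hw₁)).add
    (tendsto_finsetSum M fun k hkM =>
      (tendsto_unwanted_of_mem _ c u M hn hkM h0 hM (hk k hkM)).smul
        (((hmul (Tmat s u 0 1)).tendsto _).comp (hF (offshellVec hs (M.erase k)))))
  simp only [zero_smul, add_zero, Finset.sum_const_zero] at hR
  refine tendsto_nhds_unique hL (hR.congr' ?_)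
  filter_upwards [eventually_regular _ c M hn h0 hM, hu1, hu2] with e ⟨he, h12, h1, h2⟩ hu1 hu2
  change x₁ e ≠ x₂ e at h12
  change x₁ e ∉ M at h1
  change x₂ e ∉ M at h2
  have hW : ∀ S ⊆ M, offshellVec hs (insert (x₁ e) (insert (x₂ e) S)) =
      (Tmat s (x₁ e) 0 1 * Tmat s (x₂ e) 0 1).mulVec (offshellVec hs S) := fun S hS => by
    rw [offshellVec_insert, offshellVec_insert, Matrix.mulVec_mulVec]
    · exact fun h => h2 (hS h)
    · simpa only [Finset.mem_insert, not_or] using ⟨h12, fun h => h1 (hS h)⟩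
  have hx1 : x₁ e ∉ insert (x₂ e) M := by simpa only [Finset.mem_insert, not_or] using ⟨h12, h1⟩
  have huS : u ∉ insert (x₁ e) (insert (x₂ e) M) := by
    simpa only [Finset.mem_insert, not_or] using ⟨hu1.symm, hu2.symm, huM⟩
  have key := trace_mulVec_offshellVec hs _ u huS
  rw [Finset.sum_insert hx1, Finset.sum_insert h2, Finset.erase_insert hx1,
    Finset.erase_insert_of_ne h12, Finset.erase_insert h2, offshellVec_insert hs _ _ h1,
    offshellVec_insert hs _ _ h2, hW M subset_rfl] at key
  simp only [hV, Matrix.mulVec_smul, key, smul_add, Finset.smul_sum]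
  have hsum : ∀ k ∈ M, unwanted s.length u k ((insert (x₁ e) (insert (x₂ e) M)).erase k) •
      (Tmat s u 0 1).mulVec
        (offshellVec hs ((insert (x₁ e) (insert (x₂ e) M)).erase k)) =
      unwanted s.length u k (insert (x₁ e) (insert (x₂ e) (M.erase k))) •
      (Tmat s u 0 1).mulVec ((Tmat s (x₁ e) 0 1 * Tmat s (x₂ e) 0 1).mulVec
        (offshellVec hs (M.erase k))) := fun k hkM => by
    rw [Finset.erase_insert_of_ne (ne_of_mem_of_not_mem hkM h1).symm,
      Finset.erase_insert_of_ne (ne_of_mem_of_not_mem hkM h2).symm, hW _ (M.erase_subset k)]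
  rw [Finset.sum_congr rfl fun k hkM => congrArg _ (hsum k hkM)]
  simp only [smul_smul, add_assoc, Function.comp_def, Matrix.mulVec_smul, hx₁, hx₂]
  simp only [mul_comm]
theorem offshellVec_toFinset {N : ℕ} {s : List (Fin N)} (hs : s.Nodup) (L : List ℂ)
    (hL : L.Nodup) :
    offshellVec hs L.toFinset = (L.map fun u => Tmat s u 0 1).prod.mulVec (vac N) := by
  induction L with
  | nil => exact congrArg (Matrix.mulVec · (vac N)) (Finset.noncommProd_empty _ _)
  | cons u L ih =>
    rw [List.nodup_cons] at hL
    rw [List.toFinset_cons, offshellVec_insert hs _ _ (by simpa using hL.1), ih hL.2,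
      List.map_cons, List.prod_cons, Matrix.mulVec_mulVec]

theorem Bop_eq_Tmat (N : ℕ) (lam : ℂ) :
    Bop N lam = Tmat (List.finRange N).reverse (lam - Complex.I / 2) 0 1 := by
  ext x y
  exact monodromy_apply ..

theorem Fin.prod_univ_erase_succ {M : Type*} [CommMonoid M] {n : ℕ} (f : Fin (n + 1) → M)
    (k : Fin n) :
    ∏ j ∈ Finset.univ.erase k.succ, f j = f 0 * ∏ j ∈ Finset.univ.erase k, f j.succ := by
  simp only [← Finset.filter_ne', Finset.prod_filter]
  rw [Fin.prod_univ_succ]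
  simp [(Fin.succ_ne_zero k).symm]

/-- The first Nepomechie–Wang condition on `c`, in terms of shifted rapidities. -/
theorem nw_condition_first {m : ℕ} (N : ℕ) {c : ℂ} (mu : Fin m → ℂ)
    (hp : ∀ j, mu j ≠ Complex.I / 2) (hm : ∀ j, mu j ≠ -(Complex.I / 2))
    (hc : c = -(2 / Complex.I ^ (N + 1)) *
      ∏ j, (mu j - 3 * Complex.I / 2) / (mu j + Complex.I / 2)) :
    Complex.I ^ N * (c / Complex.I) *
        ∏ j, (1 - Complex.I / (0 - (mu j - Complex.I / 2))) =
      2 * ∏ j, (1 - -Complex.I / (0 - (mu j - Complex.I / 2))) := by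
  have hI := Complex.I_ne_zero
  have h1 : ∀ j, mu j - Complex.I / 2 ≠ 0 := fun j => sub_ne_zero.mpr (hp j)
  have h2 : ∀ j, mu j + Complex.I / 2 ≠ 0 := fun j h => hm j (eq_neg_of_add_eq_zero_left h)
  have e1 : ∀ j, 1 - Complex.I / (0 - (mu j - Complex.I / 2)) =
      (mu j + Complex.I / 2) / (mu j - Complex.I / 2) := fun j => by
    rw [zero_sub, div_neg, sub_neg_eq_add, eq_div_iff (h1 j), add_mul, div_mul_cancel₀ _ (h1 j)]
    ring
  have e2 : ∀ j, 1 - -Complex.I / (0 - (mu j - Complex.I / 2)) =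
      (mu j - 3 * Complex.I / 2) / (mu j - Complex.I / 2) := fun j => by
    rw [zero_sub, neg_div_neg_eq, eq_div_iff (h1 j), sub_mul, div_mul_cancel₀ _ (h1 j)]
    ring
  simp only [e1, e2, hc, Finset.prod_div_distrib]
  have h3 := Finset.prod_ne_zero_iff.mpr fun j (_ : j ∈ Finset.univ) => h1 j
  have h4 := Finset.prod_ne_zero_iff.mpr fun j (_ : j ∈ Finset.univ) => h2 j
  generalize ∏ j, (mu j - 3 * Complex.I / 2) = P at *
  generalize ∏ j, (mu j - Complex.I / 2) = Q at *
  generalize ∏ j, (mu j + Complex.I / 2) = R at *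
  field_simp
  linear_combination -(Complex.I ^ N * P) * Complex.I_sq

/-- The second Nepomechie–Wang condition on `c`, in terms of shifted rapidities. -/
theorem nw_condition_second {m : ℕ} (N : ℕ) {c : ℂ} (mu : Fin m → ℂ)
    (hp : ∀ j, mu j ≠ Complex.I / 2) (hm : ∀ j, mu j ≠ -(Complex.I / 2))
    (hc : c = 2 * Complex.I ^ (N + 1) *
      ∏ j, (mu j + 3 * Complex.I / 2) / (mu j - Complex.I / 2)) :
    2 * ∏ j, (1 - Complex.I / (-Complex.I - (mu j - Complex.I / 2))) =
      (-Complex.I) ^ N * (c / Complex.I) *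
        ∏ j, (1 - -Complex.I / (-Complex.I - (mu j - Complex.I / 2))) := by
  have hI := Complex.I_ne_zero
  have h1 : ∀ j, mu j - Complex.I / 2 ≠ 0 := fun j => sub_ne_zero.mpr (hp j)
  have h2 : ∀ j, mu j + Complex.I / 2 ≠ 0 := fun j h => hm j (eq_neg_of_add_eq_zero_left h)
  have h0 : ∀ j, -Complex.I - (mu j - Complex.I / 2) = -(mu j + Complex.I / 2) := fun j => by ring
  have e1 : ∀ j, 1 - Complex.I / (-Complex.I - (mu j - Complex.I / 2)) =
      (mu j + 3 * Complex.I / 2) / (mu j + Complex.I / 2) := fun j => by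
    rw [h0, div_neg, sub_neg_eq_add, eq_div_iff (h2 j), add_mul, div_mul_cancel₀ _ (h2 j)]
    ring
  have e2 : ∀ j, 1 - -Complex.I / (-Complex.I - (mu j - Complex.I / 2)) =
      (mu j - Complex.I / 2) / (mu j + Complex.I / 2) := fun j => by
    rw [h0, neg_div_neg_eq, eq_div_iff (h2 j), sub_mul, div_mul_cancel₀ _ (h2 j)]
    ring
  simp only [e1, e2, hc, Finset.prod_div_distrib]
  have h3 := Finset.prod_ne_zero_iff.mpr fun j (_ : j ∈ Finset.univ) => h1 j
  have h4 := Finset.prod_ne_zero_iff.mpr fun j (_ : j ∈ Finset.univ) => h2 j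
  have h5 : (-Complex.I) ^ N * Complex.I ^ N = 1 := by
    rw [← mul_pow]
    simp
  generalize ∏ j, (mu j + 3 * Complex.I / 2) = P at *
  generalize ∏ j, (mu j - Complex.I / 2) = Q at *
  generalize ∏ j, (mu j + Complex.I / 2) = R at *
  rw [pow_succ]
  field_simp
  linear_combination (-P) * h5

/-- The Bethe equations of the singular tuple, in terms of shifted rapidities. -/
theorem bethe_eq_shifted {m : ℕ} (N : ℕ) (mu : Fin m → ℂ) (hinj : Function.Injective mu)
    (hp : ∀ j, mu j ≠ Complex.I / 2) (hm : ∀ j, mu j ≠ -(Complex.I / 2))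
    (h3p : ∀ j, mu j ≠ 3 * Complex.I / 2)
    (hstr : ∀ j k : Fin m, j ≠ k → mu k - mu j ≠ Complex.I) (k : Fin m)
    (h : ((mu k + Complex.I / 2) / (mu k - Complex.I / 2)) ^ N =
      ∏ j ∈ Finset.univ.erase (k.succ.succ : Fin (m + 2)),
        (mu k - singTuple mu j + Complex.I) / (mu k - singTuple mu j - Complex.I)) :
    (mu k - Complex.I / 2 + Complex.I) ^ N * ((1 - Complex.I / (mu k - Complex.I / 2)) *
        ((1 - Complex.I / (mu k - Complex.I / 2 + Complex.I)) *
          ∏ j ∈ Finset.univ.erase k, (1 - Complex.I / (mu k - mu j)))) =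
      (mu k - Complex.I / 2) ^ N * ((1 - -Complex.I / (mu k - Complex.I / 2)) *
        ((1 - -Complex.I / (mu k - Complex.I / 2 + Complex.I)) *
          ∏ j ∈ Finset.univ.erase k, (1 - -Complex.I / (mu k - mu j)))) := by
  have h1 : mu k - Complex.I / 2 ≠ 0 := sub_ne_zero.mpr (hp k)
  have h2 : mu k - Complex.I / 2 + Complex.I ≠ 0 := fun h => hm k (by linear_combination h)
  have h3 : mu k - Complex.I / 2 - Complex.I ≠ 0 := fun h => h3p k (by linear_combination h)
  have h4 : ∀ j ∈ Finset.univ.erase k, mu k - mu j ≠ 0 := fun j hj =>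
    sub_ne_zero.mpr (hinj.ne (Finset.ne_of_mem_erase hj).symm)
  have h5 : ∀ j ∈ Finset.univ.erase k, mu k - mu j - Complex.I ≠ 0 := fun j hj =>
    sub_ne_zero.mpr (hstr j k (Finset.ne_of_mem_erase hj))
  have e1 : ∏ j ∈ Finset.univ.erase k, (1 - Complex.I / (mu k - mu j)) =
      (∏ j ∈ Finset.univ.erase k, (mu k - mu j - Complex.I)) /
        ∏ j ∈ Finset.univ.erase k, (mu k - mu j) := by
    rw [← Finset.prod_div_distrib]
    exact Finset.prod_congr rfl fun j hj => one_sub_div (h4 j hj)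
  have e2 : ∏ j ∈ Finset.univ.erase k, (1 - -Complex.I / (mu k - mu j)) =
      (∏ j ∈ Finset.univ.erase k, (mu k - mu j + Complex.I)) /
        ∏ j ∈ Finset.univ.erase k, (mu k - mu j) := by
    rw [← Finset.prod_div_distrib]
    refine Finset.prod_congr rfl fun j hj => ?_
    rw [one_sub_div (h4 j hj), sub_neg_eq_add]
  rw [Fin.prod_univ_erase_succ, Fin.prod_univ_erase_succ] at h
  simp only [singTuple, Fin.cons_zero, Fin.cons_succ, Finset.prod_div_distrib] at h
  have h6 := Finset.prod_ne_zero_iff.mpr h4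
  have h7 := Finset.prod_ne_zero_iff.mpr h5
  rw [show mu k + Complex.I / 2 = mu k - Complex.I / 2 + Complex.I by ring,
    show mu k - -(Complex.I / 2) + Complex.I =
      mu k - Complex.I / 2 + Complex.I + Complex.I by ring,
    show mu k - -(Complex.I / 2) - Complex.I = mu k - Complex.I / 2 by ring, div_pow,
    div_eq_iff (pow_ne_zero _ h1)] at h
  rw [h, e1, e2, one_sub_div h1, one_sub_div h2, one_sub_div h1, one_sub_div h2]
  generalize mu k - Complex.I / 2 = x at *
  simp only [add_sub_cancel_right, sub_neg_eq_add]
  field_simp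

/-- The Nepomechie–Wang state
`Ψ = lim_{ε→0} ε^{−N} B_N(λ₁(ε)) B_N(λ₂(ε)) B_N(λ₃) ⋯ B_N(λ_ℓ) |0⟩_N`
is an eigenvector of the Hamiltonian: `ℋ_N Ψ = ℰ Ψ` for some `ℰ ∈ ℂ`. -/
theorem nw_state_is_eigenvector (N : ℕ) (hN : 3 ≤ N) (J : ℝ) {m : ℕ}
    (mu : Fin m → ℂ)
    (hinj : Function.Injective mu)
    (hp : ∀ j, mu j ≠ Complex.I / 2) (hm : ∀ j, mu j ≠ -(Complex.I / 2))
    (h3p : ∀ j, mu j ≠ 3 * Complex.I / 2) (h3m : ∀ j, mu j ≠ -(3 * Complex.I / 2))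
    (hstr : ∀ j k : Fin m, j ≠ k → mu k - mu j ≠ Complex.I)
    (hBAE : ∀ k : Fin m,
      ((mu k + Complex.I / 2) / (mu k - Complex.I / 2)) ^ N =
        ∏ j ∈ Finset.univ.erase (k.succ.succ : Fin (m + 2)),
          (mu k - singTuple mu j + Complex.I) /
            (mu k - singTuple mu j - Complex.I))
    (c : ℂ)
    (hc1 : c = -(2 / Complex.I ^ (N + 1)) *
      ∏ j, (mu j - 3 * Complex.I / 2) / (mu j + Complex.I / 2))
    (hc2 : c = 2 * Complex.I ^ (N + 1) *
      ∏ j, (mu j + 3 * Complex.I / 2) / (mu j - Complex.I / 2)) :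
    ∃ Ψ : St N → ℂ, Tendsto
      (fun eps : ℂ => (eps ^ N)⁻¹ •
        (Bop N (nwLam1 N c eps) * Bop N (nwLam2 eps) *
          ((List.finRange m).map fun j => Bop N (mu j)).prod).mulVec (vac N))
      (𝓝[≠] (0 : ℂ)) (𝓝 Ψ) ∧
      ∃ E : ℂ, (Ham N J).mulVec Ψ = E • Ψ := by
  set s := (List.finRange N).reverse with hs_def
  have hs : s.Nodup := List.nodup_reverse.mpr (List.nodup_finRange N)
  have hlen : s.length = N := by simp [hs_def]
  set ν : Fin m → ℂ := fun j => mu j - Complex.I / 2 with hν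
  have hνinj : Function.Injective ν := fun i j h => hinj (sub_left_injective h)
  set M : Finset ℂ := Finset.univ.image ν with hM
  have hprod : ((List.finRange m).map fun j => Bop N (mu j)).prod.mulVec (vac N) =
      offshellVec hs M := by
    have h1 : M = ((List.finRange m).map ν).toFinset := by
      ext
      simp [hM]
    rw [h1, offshellVec_toFinset hs _ ((List.nodup_finRange m).map hνinj), List.map_map]
    simp only [Bop_eq_Tmat]
    rfl
  have h0 : (0 : ℂ) ∉ M := by
    simpa [hM, hν, sub_eq_zero] using hp
  have hI : -Complex.I ∉ M := by
    simp only [hM, hν, Finset.mem_image, Finset.mem_univ, true_and, not_exists]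
    exact fun j h => hm j (by linear_combination h)
  obtain ⟨Ψ, hΨ, hΨ'⟩ := tendsto_regularized_offshellVec hs c M (by omega) h0 hI
    (by
      rw [hlen, Finset.prod_image hνinj.injOn, Finset.prod_image hνinj.injOn]
      exact nw_condition_first N mu hp hm hc1)
    (by
      rw [hlen, Finset.prod_image hνinj.injOn, Finset.prod_image hνinj.injOn]
      exact nw_condition_second N mu hp hm hc2)
    (by
      intro x hx
      obtain ⟨k, -, rfl⟩ := Finset.mem_image.mp hx
      rw [hlen, hM, ← Finset.image_erase hνinj, Finset.prod_image hνinj.injOn,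
        Finset.prod_image hνinj.injOn]
      simpa only [hν, sub_sub_sub_cancel_right] using
        bethe_eq_shifted N mu hinj hp hm h3p hstr k (hBAE k))
  refine ⟨Ψ, ?_, Ham_eigenvector_of_trace_Tmat (by omega) J Ψ hΨ'⟩
  rw [hlen] at hΨ
  refine hΨ.congr fun e => Eq.symm ?_
  rw [← Matrix.mulVec_mulVec, hprod, Bop_eq_Tmat, Bop_eq_Tmat,
    show nwLam1 N c e - Complex.I / 2 = e + c * e ^ N by rw [nwLam1]; ring,
    show nwLam2 e - Complex.I / 2 = e - Complex.I by rw [nwLam2]; ring]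
end
end

section
/- Let N ≥ 3, c ∈ ℂ, and let λ₃, …, λ_ℓ ∈ ℂ satisfy λ_j ≠ i/2 and λ_j ≠ −i/2 for all j. With λ₁(ε) = i/2 + ε + c ε^N and λ₂(ε) = −i/2 + ε, one has lim_{ε→0} [ i · Λ′(i/2; λ₁(ε), λ₂(ε), λ₃, …, λ_ℓ) / Λ(i/2; λ₁(ε), λ₂(ε), λ₃, …, λ_ℓ) ] = N − 2 − Σ_{j=3}^{ℓ} 1/(λ_j² + 1/4), where Λ′ denotes the derivative of the rational function λ ↦ Λ(λ; λ₁(ε),…,λ_ℓ) at λ = i/2. -/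
open Complex Matrix Filter Topology

noncomputable section

/-- A function with a zero of order at least two does not contribute to the derivative. -/
lemma hasDerivAt_sub_pow_mul_zero {N : ℕ} (hN : 2 ≤ N) {a : ℂ} {g : ℂ → ℂ}
    (hg : DifferentiableAt ℂ g a) : HasDerivAt (fun z => (z - a) ^ N * g z) 0 a := by
  have h := (((hasDerivAt_id a).sub_const a).pow N).mul hg.hasDerivAt
  refine h.congr_deriv ?_
  have h1 : N - 1 ≠ 0 := by omega
  have h2 : N ≠ 0 := by omega
  simp [h1, h2]

/-- The logarithmic derivative of `Λ` at `i/2` for a tuple avoiding `±i/2`. -/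
lemma I_mul_deriv_Lam_div {N : ℕ} (hN : 2 ≤ N) {l : ℕ} (lam : Fin l → ℂ)
    (hp : ∀ j, lam j ≠ Complex.I / 2) (hm : ∀ j, lam j ≠ -(Complex.I / 2)) :
    Complex.I * deriv (fun z => Lam N z lam) (Complex.I / 2) / Lam N (Complex.I / 2) lam =
      N - ∑ j, 1 / (lam j ^ 2 + 1 / 4) := by
  set a : ℂ := Complex.I / 2 with ha
  have hsub : ∀ j, a - lam j ≠ 0 := fun j => sub_ne_zero.2 (hp j).symm
  have hsub' : ∀ j, lam j - a ≠ 0 := fun j => sub_ne_zero.2 (hp j)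
  have hadd : ∀ j, a - lam j - Complex.I ≠ 0 := fun j h => hm j (by
    linear_combination -h + 2 * ha)
  have haa : a + a = Complex.I := by rw [ha]; ring
  have haa0 : a + a ≠ 0 := by rw [haa]; exact Complex.I_ne_zero
  let f : ℂ → ℂ := fun z => (z + a) ^ N * ∏ j, (z - lam j - Complex.I) / (z - lam j)
  have hfac : ∀ j ∈ Finset.univ, DifferentiableAt ℂ
      (fun z => (z - lam j - Complex.I) / (z - lam j)) a := fun j _ =>
    DifferentiableAt.div (by fun_prop) (by fun_prop) (hsub j)
  have hprod : DifferentiableAt ℂ (fun z => ∏ j, (z - lam j - Complex.I) / (z - lam j)) a :=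
    DifferentiableAt.fun_finsetProd hfac
  have hf : DifferentiableAt ℂ f a := DifferentiableAt.mul (by fun_prop) hprod
  have hprod' : DifferentiableAt ℂ (fun z => ∏ j, (lam j - z - Complex.I) / (lam j - z)) a :=
    DifferentiableAt.fun_finsetProd fun j _ =>
      DifferentiableAt.div (by fun_prop) (by fun_prop) (hsub' j)
  have hderiv : deriv (fun z => Lam N z lam) a = deriv f a := by
    have h := hf.hasDerivAt.add (hasDerivAt_sub_pow_mul_zero hN hprod')
    rw [add_zero] at h
    exact h.deriv
  have hval : Lam N a lam = f a := by
    have h2 : N ≠ 0 := by omega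
    simp [Lam, f, ← ha, h2]
  have hlog : logDeriv f a = N / Complex.I - Complex.I⁻¹ * ∑ j, 1 / (lam j ^ 2 + 1 / 4) := by
    have hpow : logDeriv (fun z : ℂ => (z + a) ^ N) a = N / Complex.I := by
      rw [logDeriv_fun_pow (by fun_prop), logDeriv_apply]
      simp [haa, div_eq_mul_inv]
    have hterm : ∀ j, logDeriv (fun z => (z - lam j - Complex.I) / (z - lam j)) a =
        -(Complex.I⁻¹ * (1 / (lam j ^ 2 + 1 / 4))) := by
      intro j
      rw [logDeriv_div (f := fun z => z - lam j - Complex.I) (g := fun z => z - lam j) a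
        (hadd j) (hsub j) (by fun_prop) (by fun_prop), logDeriv_apply, logDeriv_apply]
      have hq : lam j ^ 2 + 1 / 4 = (a - lam j - Complex.I) * (a - lam j) := by
        rw [ha]; linear_combination (1 / 4 : ℂ) * Complex.I_sq
      have h0 := hadd j
      have h1 := hsub j
      have hI := Complex.I_ne_zero
      rw [hq]
      simp
      field_simp
      ring
    have hnum := fun j (_ : j ∈ Finset.univ) => div_ne_zero (hadd j) (hsub j)
    rw [logDeriv_mul a (f := fun z => (z + a) ^ N) (pow_ne_zero N haa0)
      (Finset.prod_ne_zero_iff.2 hnum) (by fun_prop) hprod, hpow, logDeriv_prod hnum hfac,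
      Finset.sum_congr rfl fun j _ => hterm j, Finset.sum_neg_distrib, Finset.mul_sum,
      sub_eq_add_neg]
  rw [hderiv, hval, mul_div_assoc, ← logDeriv_apply, hlog, mul_sub,
    mul_div_cancel₀ _ Complex.I_ne_zero, mul_inv_cancel_left₀ Complex.I_ne_zero]

/-- The contributions of the two regularized singular roots tend to `2`. -/
lemma tendsto_nwLam_sum (n : ℕ) (c : ℂ) :
    Tendsto (fun e : ℂ => 1 / (nwLam1 (n + 3) c e ^ 2 + 1 / 4) + 1 / (nwLam2 e ^ 2 + 1 / 4))
      (𝓝[≠] (0 : ℂ)) (𝓝 2) := by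
  let u : ℂ → ℂ := fun e => 1 + c * e ^ (n + 2)
  let d : ℂ → ℂ := fun e => u e * (Complex.I + e * u e) * (e - Complex.I)
  have hu : Continuous u := by fun_prop
  have hd : Continuous d := by fun_prop
  have hd0 : d 0 = 1 := by simp [d, u]
  have hlim : Tendsto (fun e => (1 + u e ^ 2 + Complex.I * c * e ^ (n + 1)) / d e)
      (𝓝 0) (𝓝 2) := by
    have h : ContinuousAt (fun e => (1 + u e ^ 2 + Complex.I * c * e ^ (n + 1)) / d e) 0 :=
      ContinuousAt.div (by fun_prop) hd.continuousAt (by simp [hd0])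
    convert h.tendsto using 2
    rw [hd0]
    norm_num [u]
  refine (hlim.mono_left nhdsWithin_le_nhds).congr' ?_
  have hev : ∀ᶠ e in 𝓝[≠] (0 : ℂ), d e ≠ 0 :=
    (hd.continuousAt.eventually_ne (by simp [hd0])).filter_mono nhdsWithin_le_nhds
  filter_upwards [hev, self_mem_nhdsWithin] with e he he0
  have he0 : e ≠ 0 := he0
  have h1 : nwLam1 (n + 3) c e ^ 2 + 1 / 4 = e * u e * (Complex.I + e * u e) := by
    simp only [nwLam1, u]
    linear_combination (1 / 4 : ℂ) * Complex.I_sq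
  have h2 : nwLam2 e ^ 2 + 1 / 4 = e * (e - Complex.I) := by
    simp only [nwLam2]
    linear_combination (1 / 4 : ℂ) * Complex.I_sq
  rw [h1, h2]
  have hue : u e ≠ 0 := fun h => he (by simp [d, h])
  have hve : Complex.I + e * u e ≠ 0 := fun h => he (by simp [d, h])
  have hwe : e - Complex.I ≠ 0 := fun h => he (by simp [d, h])
  obtain ⟨w, hw⟩ : ∃ w, w = Complex.I + e * u e := ⟨_, rfl⟩
  simp only [d, ← hw] at hve ⊢
  field_simp
  rw [hw]
  simp only [u]
  ring

/-- Limit of the logarithmic derivative of `Λ` at `i/2` under the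
Nepomechie–Wang regularization:
`lim_{ε→0} i Λ′(i/2)/Λ(i/2) = N − 2 − Σ_{j=3}^{ℓ} 1/(λⱼ² + 1/4)`. -/
theorem nw_log_deriv_limit (N : ℕ) (hN : 3 ≤ N) (c : ℂ) {m : ℕ}
    (mu : Fin m → ℂ)
    (hp : ∀ j, mu j ≠ Complex.I / 2) (hm : ∀ j, mu j ≠ -(Complex.I / 2)) :
    Tendsto (fun eps : ℂ =>
        Complex.I * deriv (fun z => Lam N z (nwTuple N c mu eps)) (Complex.I / 2) /
          Lam N (Complex.I / 2) (nwTuple N c mu eps))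
      (𝓝[≠] (0 : ℂ))
      (𝓝 ((N : ℂ) - 2 - ∑ j, 1 / ((mu j) ^ 2 + 1 / 4))) := by
  obtain ⟨n, rfl⟩ := Nat.exists_eq_add_of_le' hN
  have hlim := ((tendsto_nwLam_sum n c).const_sub ((n + 3 : ℕ) : ℂ)).sub_const
    (∑ j, 1 / ((mu j) ^ 2 + 1 / 4))
  refine hlim.congr' ?_
  have hu : Continuous fun e : ℂ =>
      (1 + c * e ^ (n + 2)) * (Complex.I + e + c * e ^ (n + 3)) * (e - Complex.I) := by
    fun_prop
  have hev := (hu.continuousAt (x := 0)).eventually_ne (y := 0) (by simp)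
  filter_upwards [hev.filter_mono nhdsWithin_le_nhds, self_mem_nhdsWithin] with e he he0
  have he0 : e ≠ 0 := he0
  simp only [ne_eq, mul_eq_zero, not_or] at he
  obtain ⟨⟨hue, hve⟩, hwe⟩ := he
  rw [I_mul_deriv_Lam_div (by omega)]
  · simp only [nwTuple, Fin.sum_univ_succ, Fin.cons_zero, Fin.cons_succ]
    ring
  · refine Fin.cases ?_ (Fin.cases ?_ ?_)
    · intro h
      simp only [nwTuple, Fin.cons_zero, nwLam1] at h
      exact mul_ne_zero he0 hue (by linear_combination h)
    · intro h
      simp only [nwTuple, Fin.cons_zero, Fin.cons_succ, nwLam2] at h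
      exact hwe (by linear_combination h)
    · simpa [nwTuple] using hp
  · refine Fin.cases ?_ (Fin.cases ?_ ?_)
    · intro h
      simp only [nwTuple, Fin.cons_zero, nwLam1] at h
      exact hve (by linear_combination h)
    · intro h
      simp only [nwTuple, Fin.cons_zero, Fin.cons_succ, nwLam2] at h
      exact he0 (by linear_combination h)
    · simpa [nwTuple] using hm
end
end
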